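/- arXiv:1009.1751 — 5 statements merged into one kernel-verified Lean document; each statement's English description precedes it below -/
import Mathlib

section
/- Let 0<p<∞ and let n ≥ 2 and 1 ≤ m ≤ n be natural numbers. Then ∫_{Δ_p^n} x_m* dμ_p(x) = (Γ(n/p)/Γ(n/p+1/p)) · E[ω_m*]. Furthermore, there are two positive real numbers C_p^1 and C_p^2 depending only on p such that C_p^1 · E[ω_m*]/n^{1/p} ≤ ∫_{Δ_p^n} x_m* dμ_p(x) ≤ C_p^2 · E[ω_m*]/n^{1/p}. -/
open MeasureTheory Real Set
open scoped ENNReal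

noncomputable section

/-- The `m`-th largest value among `|x_1|, …, |x_n|` (for `1 ≤ m ≤ n`). -/
def kthMax {ι : Type*} [Fintype ι] (x : ι → ℝ) (m : ℕ) : ℝ :=
  sSup {t : ℝ | ∃ S : Finset ι, m ≤ S.card ∧ ∀ j ∈ S, t ≤ |x j|}

/-- The positive part `Δ_p^n` of the unit sphere of `ℓ_p^n`:
`Δ_p^n = {t ∈ [0,∞)^n : ∑_j t_j^p = 1}`. -/
def Delta (p : ℝ) (n : ℕ) : Set (Fin n → ℝ) :=
  {t | (∀ i, 0 ≤ t i) ∧ ∑ i, t i ^ p = 1}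

/-- The cone `[0,1] · A = {t • a : t ∈ [0,1], a ∈ A}`. -/
def cone {n : ℕ} (A : Set (Fin n → ℝ)) : Set (Fin n → ℝ) :=
  {x | ∃ t ∈ Icc (0 : ℝ) 1, ∃ a ∈ A, x = t • a}

/-- `μ` is the normalized cone measure on `Δ_p^n`: it is a Borel probability measure with
`μ(A) = λ([0,1]·A) / λ([0,1]·Δ_p^n)` for every Borel `A ⊆ Δ_p^n`. -/
def IsConeMeasure (p : ℝ) (n : ℕ) (μ : Measure (Fin n → ℝ)) : Prop :=
  IsProbabilityMeasure μ ∧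
    ∀ A : Set (Fin n → ℝ), MeasurableSet A → A ⊆ Delta p n →
      μ A = volume (cone A) / volume (cone (Delta p n))

/-- The distribution on `[0,∞)` with density `c_p e^{-t^p}`, `c_p = p / Γ(1/p)`. -/
def expMeasure (p : ℝ) : Measure ℝ :=
  (volume.restrict (Ioi (0 : ℝ))).withDensity fun t =>
    ENNReal.ofReal ((p / Real.Gamma (1 / p)) * Real.exp (-(t ^ p)))

/-- Joint distribution of `n` i.i.d. random variables with density `c_p e^{-t^p}` on `[0,∞)`. -/
def iidExp (p : ℝ) (n : ℕ) : Measure (Fin n → ℝ) := Measure.pi fun _ => expMeasure p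



namespace ConeAux

/-! ### Properties of `kthMax` -/

section kth

variable {n : ℕ}

lemma kth_bdd (x : Fin n → ℝ) {m : ℕ} (hm : 1 ≤ m) :
    BddAbove {t : ℝ | ∃ S : Finset (Fin n), m ≤ S.card ∧ ∀ j ∈ S, t ≤ |x j|} := by
  refine ⟨∑ j, |x j|, ?_⟩
  rintro t ⟨S, hS, h⟩
  obtain ⟨j, hj⟩ := Finset.card_pos.1 (by omega : 0 < S.card)
  exact (h j hj).trans (Finset.single_le_sum (f := fun j => |x j|)
    (fun i _ => abs_nonneg _) (Finset.mem_univ j))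

lemma kth_zero_mem (x : Fin n → ℝ) {m : ℕ} (hm : m ≤ n) :
    (0 : ℝ) ∈ {t : ℝ | ∃ S : Finset (Fin n), m ≤ S.card ∧ ∀ j ∈ S, t ≤ |x j|} :=
  ⟨Finset.univ, by simpa using hm, fun _ _ => abs_nonneg _⟩

lemma kth_nonneg (x : Fin n → ℝ) {m : ℕ} (hm1 : 1 ≤ m) (hm : m ≤ n) : 0 ≤ kthMax x m :=
  le_csSup (kth_bdd x hm1) (kth_zero_mem x hm)

lemma kth_le (x : Fin n → ℝ) {m : ℕ} (hm1 : 1 ≤ m) (hm : m ≤ n) {c : ℝ} (hc : ∀ j, |x j| ≤ c) :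
    kthMax x m ≤ c := by
  refine csSup_le ⟨0, kth_zero_mem x hm⟩ ?_
  rintro t ⟨S, hS, h⟩
  obtain ⟨j, hj⟩ := Finset.card_pos.1 (by omega : 0 < S.card)
  exact (h j hj).trans (hc j)

lemma kth_smul (x : Fin n → ℝ) (m : ℕ) {r : ℝ} (hr : 0 < r) :
    kthMax (r • x) m = r * kthMax x m := by
  unfold kthMax
  rw [← smul_eq_mul, ← Real.sSup_smul_of_nonneg hr.le]
  congr 1
  ext t
  rw [Set.mem_smul_set_iff_inv_smul_mem₀ hr.ne']
  simp only [mem_ofPred_eq, Pi.smul_apply, smul_eq_mul, abs_mul, abs_of_pos hr]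
  simp only [inv_mul_le_iff₀ hr]

lemma kth_measurable {m : ℕ} (hm1 : 1 ≤ m) (hm : m ≤ n) :
    Measurable (fun x : Fin n → ℝ => kthMax x m) := by
  refine measurable_of_Ioi fun t => ?_
  have : (fun x : Fin n → ℝ => kthMax x m) ⁻¹' Ioi t
      = ⋃ S ∈ {S : Finset (Fin n) | m ≤ S.card}, ⋂ j ∈ S, {x | t < |x j|} := by
    ext x
    simp only [mem_preimage, mem_Ioi, mem_iUnion, mem_iInter, mem_ofPred_eq, exists_prop]
    unfold kthMax
    rw [lt_csSup_iff (kth_bdd x hm1) ⟨0, kth_zero_mem x hm⟩]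
    constructor
    · rintro ⟨b, ⟨S, hS, h⟩, hb⟩
      exact ⟨S, hS, fun j hj => hb.trans_le (h j hj)⟩
    · rintro ⟨S, hS, h⟩
      obtain ⟨j, hj, hmin⟩ := S.exists_min_image (fun j => |x j|)
        (Finset.card_pos.1 (by omega : 0 < S.card))
      exact ⟨|x j|, ⟨S, hS, hmin⟩, h j hj⟩
  rw [this]
  refine MeasurableSet.biUnion (Set.to_countable _) fun S _ => ?_
  refine Finset.measurableSet_biInter _ fun j _ => ?_
  exact measurableSet_lt measurable_const (measurable_pi_apply j).abs

end kth

/-! ### Gamma function bounds -/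

lemma gamma_upper {x a : ℝ} (hx : 0 < x) (ha : 0 < a) :
    Real.Gamma (x + a) ≤ (x + a) ^ a * Real.Gamma x := by
  have h := Real.convexOn_log_Gamma.slope_mono_adjacent (x := x) (y := x + a) (z := x + a + 1)
    hx (by simp only [mem_Ioi]; positivity) (by linarith) (by linarith)
  have hxa : 0 < x + a := by positivity
  have g1 := Real.Gamma_pos_of_pos hx
  have g2 := Real.Gamma_pos_of_pos hxa
  simp only [Function.comp, add_sub_cancel_left, div_one] at h
  rw [Real.Gamma_add_one hxa.ne', Real.log_mul hxa.ne' g2.ne', add_sub_cancel_right,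
    div_le_iff₀ ha] at h
  rw [← Real.log_le_log_iff g2 (by positivity), Real.log_mul (by positivity) g1.ne',
    Real.log_rpow hxa]
  linarith

lemma gamma_lower {x a : ℝ} (hx : 0 < x) (ha : 0 < a) :
    x / (x + a) * x ^ a * Real.Gamma x ≤ Real.Gamma (x + a) := by
  have h := Real.convexOn_log_Gamma.slope_mono_adjacent (x := x) (y := x + 1) (z := x + 1 + a)
    hx (by simp only [mem_Ioi]; positivity) (by linarith) (by linarith)
  have hxa : 0 < x + a := by positivity
  have g1 := Real.Gamma_pos_of_pos hx
  have g2 := Real.Gamma_pos_of_pos hxa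
  simp only [Function.comp, add_sub_cancel_left, div_one] at h
  rw [show x + 1 + a = x + a + 1 by ring, Real.Gamma_add_one hxa.ne', Real.Gamma_add_one hx.ne',
    Real.log_mul hxa.ne' g2.ne', Real.log_mul hx.ne' g1.ne', add_sub_cancel_right,
    le_div_iff₀ ha] at h
  rw [← Real.log_le_log_iff (by positivity) g2, Real.log_mul (by positivity) g1.ne',
    Real.log_mul (by positivity) (by positivity), Real.log_rpow hx,
    Real.log_div hx.ne' hxa.ne']
  linarith

lemma ratio_bounds {p : ℝ} (hp : 0 < p) {n : ℕ} (hn : 2 ≤ n) :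
    (p / 2) ^ (1 / p) / (n : ℝ) ^ (1 / p)
        ≤ Real.Gamma (n / p) / Real.Gamma (n / p + 1 / p) ∧
      Real.Gamma (n / p) / Real.Gamma (n / p + 1 / p)
        ≤ 2 * p ^ (1 / p) / (n : ℝ) ^ (1 / p) := by
  have hn' : (2 : ℝ) ≤ n := by exact_mod_cast hn
  have hn0 : (0 : ℝ) < n := by linarith
  have hx : 0 < (n : ℝ) / p := by positivity
  have ha : 0 < 1 / p := by positivity
  have g1 := Real.Gamma_pos_of_pos hx
  have g2 := Real.Gamma_pos_of_pos (add_pos hx ha)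
  have hu := gamma_upper hx ha
  have hl := gamma_lower hx ha
  have hnp : 0 < (n : ℝ) ^ (1 / p) := by positivity
  constructor
  · rw [div_le_div_iff₀ hnp g2]
    have h1 : (n / p + 1 / p) ^ (1 / p) ≤ (2 * n / p) ^ (1 / p) := by
      apply Real.rpow_le_rpow (by positivity) _ ha.le
      rw [← add_div]; gcongr; linarith
    have h2 : (p / 2) ^ (1 / p) * (2 * n / p) ^ (1 / p) = (n : ℝ) ^ (1 / p) := by
      rw [← Real.mul_rpow (by positivity) (by positivity)]; congr 1; field_simp
    calc (p / 2) ^ (1 / p) * Real.Gamma (n / p + 1 / p)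
        ≤ (p / 2) ^ (1 / p) * ((2 * n / p) ^ (1 / p) * Real.Gamma (n / p)) := by
          gcongr; exact hu.trans (by gcongr)
      _ = Real.Gamma (n / p) * (n : ℝ) ^ (1 / p) := by rw [← mul_assoc, h2, mul_comm]
  · rw [div_le_div_iff₀ g2 hnp]
    have h1 : (1 : ℝ) / 2 ≤ (n / p) / (n / p + 1 / p) := by
      rw [← add_div, div_div_div_cancel_right₀ hp.ne', div_le_div_iff₀ (by norm_num) (by linarith)]
      linarith
    have h2 : p ^ (1 / p) * ((n : ℝ) / p) ^ (1 / p) = (n : ℝ) ^ (1 / p) := by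
      rw [← Real.mul_rpow (by positivity) (by positivity)]; congr 1; field_simp
    have h3 : 1 / 2 * (n / p : ℝ) ^ (1 / p) * Real.Gamma (n / p) ≤ Real.Gamma (n / p + 1 / p) :=
      le_trans (by gcongr) hl
    calc Real.Gamma (n / p) * (n : ℝ) ^ (1 / p)
        = 2 * p ^ (1 / p) * (1 / 2 * (n / p : ℝ) ^ (1 / p) * Real.Gamma (n / p)) := by
          rw [← h2]; ring
      _ ≤ _ := by gcongr

/-! ### The orthant, `q x = ∑ x_i ^ p`, and scaling -/

/-- The open positive orthant. -/
def orth (n : ℕ) : Set (Fin n → ℝ) := Set.univ.pi fun _ => Ioi 0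

/-- `q x = ∑ x_i ^ p`. -/
def q (p : ℝ) {n : ℕ} (x : Fin n → ℝ) : ℝ := ∑ i, x i ^ p

lemma orth_meas (n : ℕ) : MeasurableSet (orth n) :=
  MeasurableSet.univ_pi fun _ => measurableSet_Ioi

lemma mem_orth {n : ℕ} {x : Fin n → ℝ} : x ∈ orth n ↔ ∀ i, 0 < x i := by
  simp [orth]

lemma q_meas (p : ℝ) (n : ℕ) : Measurable (q p : (Fin n → ℝ) → ℝ) := by
  unfold q
  exact Finset.measurable_sum _ fun i _ => (measurable_pi_apply i).pow_const p

lemma q_smul (p : ℝ) {n : ℕ} {x : Fin n → ℝ} (hx : ∀ i, 0 ≤ x i) {r : ℝ} (hr : 0 ≤ r) :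
    q p (r • x) = r ^ p * q p x := by
  simp only [q, Pi.smul_apply, smul_eq_mul, Finset.mul_sum]
  exact Finset.sum_congr rfl fun i _ => Real.mul_rpow hr (hx i)

lemma q_pos (p : ℝ) {n : ℕ} (hn : 2 ≤ n) {x : Fin n → ℝ} (hx : x ∈ orth n) : 0 < q p x := by
  rw [mem_orth] at hx
  have : Nonempty (Fin n) := ⟨⟨0, by omega⟩⟩
  exact Finset.sum_pos (fun i _ => Real.rpow_pos_of_pos (hx i) p) Finset.univ_nonempty

lemma orth_smul {n : ℕ} {x : Fin n → ℝ} {r : ℝ} (hr : 0 < r) : r • x ∈ orth n ↔ x ∈ orth n := by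
  simp [mem_orth, hr]

/-- Change of variables `x ↦ r x` in a Lebesgue integral. -/
lemma lintegral_scale {n : ℕ} {r : ℝ} (hr : 0 < r) (f : (Fin n → ℝ) → ℝ≥0∞) (hf : Measurable f) :
    ∫⁻ x, f x = ENNReal.ofReal (r ^ n) * ∫⁻ x, f (r • x) := by
  have h := Measure.map_addHaar_smul (volume : Measure (Fin n → ℝ)) hr.ne'
  have h2 : ∫⁻ x, f (r • x) = ∫⁻ x, f x ∂(Measure.map (r • ·) (volume : Measure (Fin n → ℝ))) :=
    (lintegral_map hf (measurable_const_smul r)).symm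
  rw [h2, h, lintegral_smul_measure, smul_eq_mul, ← mul_assoc, Module.finrank_fin_fun,
    ← ENNReal.ofReal_mul (by positivity), abs_of_pos (by positivity),
    mul_inv_cancel₀ (by positivity), ENNReal.ofReal_one, one_mul]

/-- The truncated orthant `{x > 0 : q x ≤ s}`. -/
def ball (p : ℝ) (n : ℕ) (s : ℝ) : Set (Fin n → ℝ) := orth n ∩ {x | q p x ≤ s}

lemma ball_meas (p : ℝ) (n : ℕ) (s : ℝ) : MeasurableSet (ball p n s) :=
  (orth_meas n).inter (measurableSet_le (q_meas p n) measurable_const)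

/-- Homogeneity of degree `k` on the orthant. -/
def Homog (n k : ℕ) (F : (Fin n → ℝ) → ℝ≥0∞) : Prop :=
  ∀ r : ℝ, 0 < r → ∀ x ∈ orth n, F (r • x) = ENNReal.ofReal (r ^ k) * F x

lemma ball_scale {p : ℝ} (hp : 0 < p) {n k : ℕ} {F : (Fin n → ℝ) → ℝ≥0∞} (hF : Measurable F)
    (hk : Homog n k F) {s : ℝ} (hs : 0 < s) :
    ∫⁻ x in ball p n s, F x
      = ENNReal.ofReal (s ^ (((n : ℝ) + k) / p)) * ∫⁻ x in ball p n 1, F x := by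
  have hr : 0 < s ^ (1 / p) := by positivity
  rw [← lintegral_indicator (ball_meas p n s), ← lintegral_indicator (ball_meas p n 1),
    lintegral_scale hr _ (hF.indicator (ball_meas p n s))]
  have : ∀ x, (ball p n s).indicator F (s ^ (1 / p) • x)
      = ENNReal.ofReal ((s ^ (1 / p)) ^ k) * (ball p n 1).indicator F x := by
    intro x
    have hmem : s ^ (1 / p) • x ∈ ball p n s ↔ x ∈ ball p n 1 := by
      simp only [ball, mem_inter_iff, mem_ofPred_eq, orth_smul hr]
      refine and_congr_right fun hx => ?_
      rw [q_smul p (fun i => (mem_orth.1 hx i).le) hr.le, ← Real.rpow_mul hs.le,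
        one_div_mul_cancel hp.ne', Real.rpow_one]
      exact mul_le_iff_le_one_right hs
    by_cases hx : x ∈ ball p n 1
    · rw [indicator_of_mem hx, indicator_of_mem (hmem.2 hx), hk _ hr x hx.1]
    · rw [indicator_of_notMem hx, indicator_of_notMem (mt hmem.1 hx), mul_zero]
  simp_rw [this]
  rw [lintegral_const_mul _ (hF.indicator (ball_meas p n 1)), ← mul_assoc,
    ← ENNReal.ofReal_mul (by positivity), ← pow_add, ← Real.rpow_natCast, ← Real.rpow_mul hs.le]
  congr 3
  push_cast; ring

/-- Tonelli: integrate a radial weight against a homogeneous function. -/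
lemma tonelli {p : ℝ} (hp : 0 < p) {n k : ℕ} {F : (Fin n → ℝ) → ℝ≥0∞} (hF : Measurable F)
    (hk : Homog n k F) {w : ℝ → ℝ≥0∞} (hw : Measurable w) :
    ∫⁻ x in orth n, F x * ∫⁻ s in Ioi 0, (Ici (q p x)).indicator w s
      = (∫⁻ s in Ioi 0, w s * ENNReal.ofReal (s ^ (((n : ℝ) + k) / p)))
          * ∫⁻ x in ball p n 1, F x := by
  have hset : MeasurableSet {z : (Fin n → ℝ) × ℝ | q p z.1 ≤ z.2} :=
    measurableSet_le ((q_meas p n).comp measurable_fst) measurable_snd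
  have hind : Measurable fun z : (Fin n → ℝ) × ℝ => (Ici (q p z.1)).indicator w z.2 := by
    have : (fun z : (Fin n → ℝ) × ℝ => (Ici (q p z.1)).indicator w z.2)
        = {z : (Fin n → ℝ) × ℝ | q p z.1 ≤ z.2}.indicator (fun z => w z.2) := by
      ext z; simp [indicator]
    rw [this]
    exact (hw.comp measurable_snd).indicator hset
  calc ∫⁻ x in orth n, F x * ∫⁻ s in Ioi 0, (Ici (q p x)).indicator w s
      = ∫⁻ x in orth n, ∫⁻ s in Ioi 0, F x * (Ici (q p x)).indicator w s := by
        refine lintegral_congr fun x => ?_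
        rw [lintegral_const_mul _ (hw.indicator measurableSet_Ici)]
    _ = ∫⁻ s in Ioi 0, ∫⁻ x in orth n, F x * (Ici (q p x)).indicator w s := by
        refine lintegral_lintegral_swap (Measurable.aemeasurable ?_)
        exact (hF.comp measurable_fst).mul hind
    _ = ∫⁻ s in Ioi 0, w s * ENNReal.ofReal (s ^ (((n : ℝ) + k) / p))
          * ∫⁻ x in ball p n 1, F x := by
        refine setLIntegral_congr_fun measurableSet_Ioi fun s hs => ?_
        try dsimp only
        rw [mul_assoc, ← ball_scale hp hF hk hs, ← lintegral_const_mul _ hF, ball,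
          inter_comm, ← Measure.restrict_restrict (measurableSet_le (q_meas p n) measurable_const),
          ← lintegral_indicator (measurableSet_le (q_meas p n) measurable_const)]
        refine lintegral_congr fun x => ?_
        by_cases hx : q p x ≤ s
        · simp [indicator, hx, mul_comm]
        · simp [indicator, hx]
    _ = _ := by
        rw [lintegral_mul_const]
        exact hw.mul (by fun_prop)

lemma exp_tail {c : ℝ} (hc : 0 < c) :
    ∫⁻ s in Ioi 0, (Ici c).indicator (fun s => ENNReal.ofReal (Real.exp (-s))) s
      = ENNReal.ofReal (Real.exp (-c)) := by
  rw [lintegral_indicator measurableSet_Ici, Measure.restrict_restrict measurableSet_Ici,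
    inter_eq_left.2 (Ici_subset_Ioi.2 hc), ← integral_exp_neg_Ioi c,
    setLIntegral_congr Ioi_ae_eq_Ici.symm,
    ofReal_integral_eq_lintegral_ofReal (integrableOn_exp_neg_Ioi c)]
  exact Filter.Eventually.of_forall fun x => (Real.exp_pos _).le

lemma exp_moment {a : ℝ} (ha : 0 ≤ a) :
    ∫⁻ s in Ioi 0, ENNReal.ofReal (Real.exp (-s)) * ENNReal.ofReal (s ^ a)
      = ENNReal.ofReal (Real.Gamma (a + 1)) := by
  have h1 : 0 < a + 1 := by linarith
  rw [Real.Gamma_eq_integral h1,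
    ofReal_integral_eq_lintegral_ofReal (Real.GammaIntegral_convergent h1)]
  · refine setLIntegral_congr_fun measurableSet_Ioi fun s hs => ?_
    try dsimp only
    rw [← ENNReal.ofReal_mul (Real.exp_pos _).le, add_sub_cancel_right]
  · refine (ae_restrict_iff' measurableSet_Ioi).2 (Filter.Eventually.of_forall fun s hs => ?_)
    have : (0 : ℝ) < s := hs
    simp only [Pi.zero_apply]; positivity

/-- Integration of a homogeneous function against `exp (-q)`. -/
lemma exp_identity {p : ℝ} (hp : 0 < p) {n k : ℕ} (hn : 2 ≤ n) {F : (Fin n → ℝ) → ℝ≥0∞}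
    (hF : Measurable F) (hk : Homog n k F) :
    ∫⁻ x in orth n, F x * ENNReal.ofReal (Real.exp (-q p x))
      = ENNReal.ofReal (Real.Gamma (((n : ℝ) + k) / p + 1)) * ∫⁻ x in ball p n 1, F x := by
  rw [← exp_moment (by positivity), ← tonelli hp hF hk (by fun_prop)]
  refine setLIntegral_congr_fun (orth_meas n) fun x hx => ?_
  try dsimp only
  rw [exp_tail (q_pos p hn hx)]

lemma rpow_lint {a c : ℝ} (ha : -1 < a) (hc : 0 ≤ c) (hc1 : c ≤ 1) :
    ∫⁻ s in Ioc c 1, ENNReal.ofReal ((a + 1) * s ^ a) = ENNReal.ofReal (1 - c ^ (a + 1)) := by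
  have hi : IntervalIntegrable (fun s : ℝ => (a + 1) * s ^ a) volume c 1 :=
    (intervalIntegral.intervalIntegrable_rpow' ha).const_mul _
  have h : ∫ s in c..1, (a + 1) * s ^ a = 1 - c ^ (a + 1) := by
    rw [intervalIntegral.integral_const_mul, integral_rpow (Or.inl ha), Real.one_rpow,
      mul_div_cancel₀ _ (by linarith)]
  rw [← h, intervalIntegral.integral_of_le hc1, ofReal_integral_eq_lintegral_ofReal
    ((intervalIntegrable_iff_integrableOn_Ioc_of_le hc1).1 hi)]
  refine (ae_restrict_iff' measurableSet_Ioc).2 (Filter.Eventually.of_forall fun s hs => ?_)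
  have h1 : (0 : ℝ) < s := hc.trans_lt hs.1
  have h2 : 0 < a + 1 := by linarith
  simp only [Pi.zero_apply]; positivity

/-- For a `0`-homogeneous `h`: the integral of `h * (1 - N)` over the ball is `1/(n+1)` of that
of `h`. -/
lemma one_sub_identity {p : ℝ} (hp : 0 < p) {n : ℕ} (hn : 2 ≤ n) {h : (Fin n → ℝ) → ℝ≥0∞}
    (hh : Measurable h) (hk : Homog n 0 h) :
    ∫⁻ x in ball p n 1, h x * ENNReal.ofReal (1 - q p x ^ (1 / p))
      = ENNReal.ofReal (1 / ((n : ℝ) + 1)) * ∫⁻ x in ball p n 1, h x := by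
  set a : ℝ := 1 / p - 1 with ha_def
  have hp1 : 0 < 1 / p := by positivity
  have ha : -1 < a := by linarith
  have ha1 : a + 1 = 1 / p := by ring
  set w : ℝ → ℝ≥0∞ := (Iic (1 : ℝ)).indicator fun s => ENNReal.ofReal ((a + 1) * s ^ a) with hw_def
  have hw : Measurable w := Measurable.indicator (by fun_prop) measurableSet_Iic
  have key := tonelli hp hh hk hw
  have e1 : ∫⁻ s in Ioi 0, w s * ENNReal.ofReal (s ^ (((n : ℝ) + (0 : ℕ)) / p))
      = ENNReal.ofReal (1 / ((n : ℝ) + 1)) := by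
    have hb : -1 < a + n / p := by
      have : 0 ≤ (n : ℝ) / p := by positivity
      linarith
    have hb1 : a + n / p + 1 = (n + 1) / p := by rw [ha_def]; ring
    have := rpow_lint hb le_rfl zero_le_one
    rw [Real.zero_rpow (by linarith), sub_zero, ENNReal.ofReal_one] at this
    rw [← mul_one (ENNReal.ofReal (1 / ((n : ℝ) + 1))), ← this,
      ← lintegral_const_mul _ (by fun_prop), ← Ioi_inter_Iic, inter_comm,
      ← Measure.restrict_restrict measurableSet_Iic, ← lintegral_indicator measurableSet_Iic]
    refine setLIntegral_congr_fun measurableSet_Ioi fun s hs => ?_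
    have hs0 : (0 : ℝ) < s := hs
    by_cases h1 : s ≤ 1
    · simp only [hw_def, indicator, mem_Iic, h1, if_true]
      rw [← ENNReal.ofReal_mul (by rw [ha1]; positivity), ← ENNReal.ofReal_mul (by positivity),
        hb1, ha1, Real.rpow_add hs0]
      congr 1
      simp only [Nat.cast_zero, add_zero]
      field_simp
    · simp [hw_def, indicator, h1]
  rw [e1] at key
  rw [← key, ball, inter_comm,
    ← Measure.restrict_restrict (measurableSet_le (q_meas p n) measurable_const),
    ← lintegral_indicator (measurableSet_le (q_meas p n) measurable_const)]
  refine setLIntegral_congr_fun (orth_meas n) fun x hx => ?_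
  have hq := q_pos p hn hx
  have e2 : ∫⁻ s in Ioi 0, (Ici (q p x)).indicator w s
      = ∫⁻ s in Icc (q p x) 1, ENNReal.ofReal ((a + 1) * s ^ a) := by
    rw [hw_def, indicator_indicator, Ici_inter_Iic, lintegral_indicator measurableSet_Icc,
      Measure.restrict_restrict measurableSet_Icc,
      inter_eq_left.2 (Icc_subset_Ici_self.trans (Ici_subset_Ioi.2 hq))]
  try dsimp only
  rw [e2]
  by_cases h1 : q p x ≤ 1
  · rw [setLIntegral_congr Ioc_ae_eq_Icc.symm, rpow_lint ha hq.le h1, ha1]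
    simp [indicator, h1]
  · rw [Icc_eq_empty h1]
    simp [indicator, h1]

/-- For a `0`-homogeneous `h`: the integral of `h * N` over the ball. -/
lemma mul_norm_identity {p : ℝ} (hp : 0 < p) {n : ℕ} (hn : 2 ≤ n) {h : (Fin n → ℝ) → ℝ≥0∞}
    (hh : Measurable h) (hk : Homog n 0 h) (hfin : ∫⁻ x in ball p n 1, h x ≠ ∞) :
    ∫⁻ x in ball p n 1, h x * ENNReal.ofReal (q p x ^ (1 / p))
      = ENNReal.ofReal (n / ((n : ℝ) + 1)) * ∫⁻ x in ball p n 1, h x := by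
  have h1 := one_sub_identity hp hn hh hk
  have hq := q_meas p n
  have hsum : (∫⁻ x in ball p n 1, h x * ENNReal.ofReal (q p x ^ (1 / p)))
      + ∫⁻ x in ball p n 1, h x * ENNReal.ofReal (1 - q p x ^ (1 / p))
      = ∫⁻ x in ball p n 1, h x := by
    rw [← lintegral_add_left (by fun_prop)]
    refine setLIntegral_congr_fun (ball_meas p n 1) fun x hx => ?_
    have hq0 := q_pos p hn hx.1
    have hq1 : q p x ^ (1 / p) ≤ 1 := Real.rpow_le_one hq0.le hx.2 (by positivity)
    try dsimp only
    rw [← mul_add, ← ENNReal.ofReal_add (by positivity) (by linarith)]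
    simp
  have hsum2 : ENNReal.ofReal (n / ((n : ℝ) + 1)) * (∫⁻ x in ball p n 1, h x)
      + ENNReal.ofReal (1 / ((n : ℝ) + 1)) * (∫⁻ x in ball p n 1, h x)
      = ∫⁻ x in ball p n 1, h x := by
    rw [← add_mul, ← ENNReal.ofReal_add (by positivity) (by positivity), ← add_div,
      div_self (by positivity), ENNReal.ofReal_one, one_mul]
  rw [h1] at hsum
  exact (ENNReal.add_left_inj (ENNReal.mul_ne_top ENNReal.ofReal_ne_top hfin)).1
    (hsum.trans hsum2.symm)

/-! ### The i.i.d. distribution -/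

lemma c_pos {p : ℝ} (hp : 0 < p) : 0 < p / Real.Gamma (1 / p) :=
  div_pos hp (Real.Gamma_pos_of_pos (by positivity))

lemma integrable_dens {p : ℝ} (hp : 0 < p) :
    Integrable (fun t : ℝ => (p / Real.Gamma (1 / p)) * Real.exp (-(t ^ p)))
      (volume.restrict (Ioi 0)) := by
  have := integrableOn_rpow_mul_exp_neg_rpow (p := p) (s := 0) (by norm_num) hp
  simp only [Real.rpow_zero, one_mul] at this
  exact Integrable.const_mul this _

lemma expMeasure_prob {p : ℝ} (hp : 0 < p) : IsProbabilityMeasure (expMeasure p) := by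
  constructor
  have hg : 0 < Real.Gamma (1 / p) := Real.Gamma_pos_of_pos (by positivity)
  rw [expMeasure, withDensity_apply _ MeasurableSet.univ, Measure.restrict_univ,
    ← ofReal_integral_eq_lintegral_ofReal (integrable_dens hp), integral_const_mul,
    integral_exp_neg_rpow hp, Real.Gamma_add_one (by positivity)]
  · rw [← ENNReal.ofReal_one]; congr 1; field_simp
  · have := c_pos hp
    exact Filter.Eventually.of_forall fun x => by simp only [Pi.zero_apply]; positivity

lemma iid_eq {p : ℝ} (hp : 0 < p) (n : ℕ) :
    iidExp p n = (volume.restrict (orth n)).withDensity fun x =>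
      ENNReal.ofReal ((p / Real.Gamma (1 / p)) ^ n) * ENNReal.ofReal (Real.exp (-q p x)) := by
  have := expMeasure_prob hp
  have hc := c_pos hp
  refine Measure.pi_eq fun s hs => ?_
  rw [withDensity_apply _ (MeasurableSet.univ_pi hs)]
  have hV : (volume.restrict (orth n)).restrict (univ.pi s)
      = Measure.pi fun i => (volume.restrict (Ioi (0 : ℝ))).restrict (s i) := by
    rw [orth, volume_pi, Measure.restrict_pi_pi, Measure.restrict_pi_pi]
  have hf : ∀ x : Fin n → ℝ, ENNReal.ofReal ((p / Real.Gamma (1 / p)) ^ n)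
      * ENNReal.ofReal (Real.exp (-q p x))
      = ENNReal.ofReal (∏ i, (p / Real.Gamma (1 / p)) * Real.exp (-(x i ^ p))) := by
    intro x
    rw [← ENNReal.ofReal_mul (by positivity), Finset.prod_mul_distrib, ← Real.exp_sum]
    simp [q, div_pow]
  have hi : ∀ i, Integrable (fun t : ℝ => (p / Real.Gamma (1 / p)) * Real.exp (-(t ^ p)))
      ((volume.restrict (Ioi (0 : ℝ))).restrict (s i)) := fun i => (integrable_dens hp).restrict
  simp_rw [hf]
  rw [hV, ← ofReal_integral_eq_lintegral_ofReal (Integrable.fintype_prod hi),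
    integral_fintype_prod_eq_prod
      (f := fun _ (t : ℝ) => (p / Real.Gamma (1 / p)) * Real.exp (-(t ^ p))),
    ENNReal.ofReal_prod_of_nonneg]
  · refine Finset.prod_congr rfl fun i _ => ?_
    rw [ofReal_integral_eq_lintegral_ofReal (hi i), expMeasure, withDensity_apply _ (hs i)]
    exact Filter.Eventually.of_forall fun x => by simp only [Pi.zero_apply]; positivity
  · exact fun i _ => integral_nonneg fun x => by simp only [Pi.zero_apply]; positivity
  · exact Filter.Eventually.of_forall fun x => by simp only [Pi.zero_apply]; positivity

lemma iid_lintegral {p : ℝ} (hp : 0 < p) {n k : ℕ} (hn : 2 ≤ n) {F : (Fin n → ℝ) → ℝ≥0∞}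
    (hF : Measurable F) (hk : Homog n k F) :
    ∫⁻ x, F x ∂(iidExp p n) = ENNReal.ofReal ((p / Real.Gamma (1 / p)) ^ n)
      * (ENNReal.ofReal (Real.Gamma (((n : ℝ) + k) / p + 1)) * ∫⁻ x in ball p n 1, F x) := by
  have hq := q_meas p n
  rw [iid_eq hp, lintegral_withDensity_eq_lintegral_mul _ (by fun_prop) hF,
    ← exp_identity hp hn hF hk, ← lintegral_const_mul _ (by fun_prop)]
  refine lintegral_congr fun x => ?_
  simp only [Pi.mul_apply]
  ring

lemma ball_volume {p : ℝ} (hp : 0 < p) {n : ℕ} (hn : 2 ≤ n) :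
    ENNReal.ofReal ((p / Real.Gamma (1 / p)) ^ n)
      * (ENNReal.ofReal (Real.Gamma ((n : ℝ) / p + 1)) * volume (ball p n 1)) = 1 := by
  have := expMeasure_prob hp
  have h := iid_lintegral hp hn (k := 0) (F := fun _ => 1) measurable_const (by intro r _ x _; simp)
  have h1 : iidExp p n univ = 1 := by
    unfold iidExp; exact measure_univ
  simpa [h1] using h.symm

/-! ### The cone measure -/

/-- Radial projection onto `Delta`. -/
def proj (p : ℝ) {n : ℕ} (x : Fin n → ℝ) : Fin n → ℝ := q p x ^ (-(1 / p)) • x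

lemma proj_meas (p : ℝ) (n : ℕ) : Measurable (proj p : (Fin n → ℝ) → Fin n → ℝ) := by
  have hq := q_meas p n
  unfold proj
  fun_prop

lemma proj_mem {p : ℝ} (hp : 0 < p) {n : ℕ} (hn : 2 ≤ n) {x : Fin n → ℝ} (hx : x ∈ orth n) :
    proj p x ∈ Delta p n := by
  have hq := q_pos p hn hx
  have hx' := mem_orth.1 hx
  refine ⟨fun i => mul_nonneg (by positivity) (hx' i).le, ?_⟩
  change q p (q p x ^ (-(1 / p)) • x) = 1
  rw [q_smul p (fun i => (hx' i).le) (by positivity), ← Real.rpow_mul hq.le, neg_mul,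
    one_div_mul_cancel hp.ne', Real.rpow_neg_one, inv_mul_cancel₀ hq.ne']

lemma proj_smul {p : ℝ} (hp : 0 < p) {n : ℕ} {x : Fin n → ℝ} (hx : ∀ i, 0 ≤ x i)
    {r : ℝ} (hr : 0 < r) : proj p (r • x) = proj p x := by
  have hq : 0 ≤ q p x := Finset.sum_nonneg fun i _ => Real.rpow_nonneg (hx i) p
  rw [proj, proj, q_smul p hx hr.le, smul_smul, Real.mul_rpow (by positivity) hq,
    ← Real.rpow_mul hr.le, mul_neg, mul_one_div_cancel hp.ne', Real.rpow_neg_one]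
  congr 1
  field_simp

lemma smul_proj {p : ℝ} {n : ℕ} (hn : 2 ≤ n) {x : Fin n → ℝ} (hx : x ∈ orth n) :
    q p x ^ (1 / p) • proj p x = x := by
  have hq := q_pos p hn hx
  rw [proj, smul_smul, ← Real.rpow_add hq, add_neg_cancel, Real.rpow_zero, one_smul]

lemma cone_inter {p : ℝ} (hp : 0 < p) {n : ℕ} (hn : 2 ≤ n) {A : Set (Fin n → ℝ)}
    (hA : A ⊆ Delta p n) : cone A ∩ orth n = ball p n 1 ∩ proj p ⁻¹' A := by
  ext x
  constructor
  · rintro ⟨⟨t, ⟨ht0, ht1⟩, a, ha, rfl⟩, hx⟩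
    have htpos : 0 < t := by
      rcases ht0.eq_or_lt with h | h
      · subst h
        have := mem_orth.1 hx ⟨0, by omega⟩
        simp at this
      · exact h
    obtain ⟨ha0, ha1⟩ := hA ha
    change q p a = 1 at ha1
    refine ⟨⟨hx, ?_⟩, ?_⟩
    · simp only [mem_ofPred_eq, q_smul p ha0 ht0, ha1, mul_one]
      exact Real.rpow_le_one ht0 ht1 hp.le
    · rw [mem_preimage, proj_smul hp ha0 htpos, proj, ha1, Real.one_rpow, one_smul]
      exact ha
  · rintro ⟨⟨hx, hq⟩, hxA⟩
    have hq0 := q_pos p hn hx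
    exact ⟨⟨q p x ^ (1 / p), ⟨by positivity, Real.rpow_le_one hq0.le hq (by positivity)⟩,
      proj p x, hxA, (smul_proj hn hx).symm⟩, hx⟩

lemma cone_volume {p : ℝ} (hp : 0 < p) {n : ℕ} (hn : 2 ≤ n) {A : Set (Fin n → ℝ)}
    (hA : A ⊆ Delta p n) : volume (cone A) = volume (ball p n 1 ∩ proj p ⁻¹' A) := by
  rw [← cone_inter hp hn hA]
  have h0 : cone A ⊆ Ici 0 := by
    rintro x ⟨t, ⟨ht0, -⟩, a, ha, rfl⟩ i
    exact mul_nonneg ht0 ((hA ha).1 i)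
  have h1 : (orth n : Set (Fin n → ℝ)) =ᵐ[volume] (Ici 0 : Set (Fin n → ℝ)) :=
    Measure.univ_pi_Ioi_ae_eq_Ici
  rw [measure_congr ((ae_eq_refl (cone A)).inter h1), inter_eq_left.2 h0]

lemma delta_meas (p : ℝ) (n : ℕ) : MeasurableSet (Delta p n) := by
  have h : Delta p n = {t | ∀ i, 0 ≤ t i} ∩ {t | q p t = 1} := rfl
  rw [h]
  refine MeasurableSet.inter ?_ (measurableSet_eq_fun (q_meas p n) measurable_const)
  have : {t : Fin n → ℝ | ∀ i, 0 ≤ t i} = Ici 0 := rfl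
  rw [this]
  exact measurableSet_Ici

lemma cone_delta_volume {p : ℝ} (hp : 0 < p) {n : ℕ} (hn : 2 ≤ n) :
    volume (cone (Delta p n)) = volume (ball p n 1) := by
  rw [cone_volume hp hn Subset.rfl, inter_eq_left.2]
  exact fun x hx => proj_mem hp hn hx.1

lemma ball_ne {p : ℝ} (hp : 0 < p) {n : ℕ} (hn : 2 ≤ n) :
    volume (ball p n 1) ≠ 0 ∧ volume (ball p n 1) ≠ ∞ := by
  have h := ball_volume hp hn
  have hc := c_pos hp
  have hg : 0 < Real.Gamma ((n : ℝ) / p + 1) := Real.Gamma_pos_of_pos (by positivity)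
  constructor
  · intro h0
    rw [h0] at h; simp at h
  · intro h0
    rw [h0, ENNReal.mul_top (by simpa using hg), ENNReal.mul_top (by simp; positivity)] at h
    simp at h

lemma cone_eq {p : ℝ} (hp : 0 < p) {n : ℕ} (hn : 2 ≤ n) {μ : Measure (Fin n → ℝ)}
    (hμ : IsConeMeasure p n μ) :
    μ = (volume (ball p n 1))⁻¹ • Measure.map (proj p) (volume.restrict (ball p n 1)) := by
  obtain ⟨hprob, hμ⟩ := hμ
  obtain ⟨hb0, hb1⟩ := ball_ne hp hn
  have hD : μ (Delta p n) = 1 := by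
    rw [hμ _ (delta_meas p n) Subset.rfl, cone_delta_volume hp hn, ENNReal.div_self hb0 hb1]
  have hDc : μ (Delta p n)ᶜ = 0 := (prob_compl_eq_zero_iff (delta_meas p n)).2 hD
  ext B hB
  have h1 : μ B = μ (B ∩ Delta p n) := (measure_inter_conull hDc).symm
  rw [h1, hμ _ (hB.inter (delta_meas p n)) inter_subset_right, cone_delta_volume hp hn,
    cone_volume hp hn inter_subset_right, Measure.smul_apply, smul_eq_mul,
    Measure.map_apply (proj_meas p n) hB, Measure.restrict_apply (proj_meas p n hB),
    ENNReal.div_eq_inv_mul]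
  congr 2
  ext x
  constructor
  · rintro ⟨h1, h2, h3⟩; exact ⟨h2, h1⟩
  · rintro ⟨h1, h2⟩; exact ⟨h2, h1, proj_mem hp hn h2.1⟩

/-- The first claim. -/
lemma main_eq {p : ℝ} (hp : 0 < p) {n : ℕ} (hn : 2 ≤ n) {m : ℕ} (hm1 : 1 ≤ m) (hm : m ≤ n)
    {μ : Measure (Fin n → ℝ)} (hμ : IsConeMeasure p n μ) :
    ∫ x, kthMax x m ∂μ
      = (Real.Gamma (n / p) / Real.Gamma (n / p + 1 / p)) * ∫ ω, kthMax ω m ∂(iidExp p n) := by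
  have hg := kth_measurable hm1 hm
  obtain ⟨hb0, hb1⟩ := ball_ne hp hn
  set F : (Fin n → ℝ) → ℝ≥0∞ := fun x => ENNReal.ofReal (kthMax x m) with hF_def
  have hF : Measurable F := by fun_prop
  have hF1 : Homog n 1 F := by
    intro r hr x _
    simp only [hF_def]
    rw [kth_smul x m hr, ENNReal.ofReal_mul hr.le, pow_one]
  have hh : Measurable fun x => F (proj p x) := hF.comp (proj_meas p n)
  have hh0 : Homog n 0 fun x => F (proj p x) := by
    intro r hr x hx
    dsimp only
    rw [proj_smul hp (fun i => (mem_orth.1 hx i).le) hr]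
    simp
  have hfin : ∫⁻ x in ball p n 1, F (proj p x) ≠ ∞ := by
    refine ne_top_of_le_ne_top hb1 ?_
    calc ∫⁻ x in ball p n 1, F (proj p x) ≤ ∫⁻ x in ball p n 1, 1 := by
          refine setLIntegral_mono measurable_const fun x hx => ?_
          rw [← ENNReal.ofReal_one]
          refine ENNReal.ofReal_le_ofReal (kth_le _ hm1 hm fun j => ?_)
          obtain ⟨h0, h1⟩ := proj_mem hp hn hx.1
          rw [abs_of_nonneg (h0 j)]
          by_contra hlt
          push Not at hlt
          have h2 : 1 < proj p x j ^ p := Real.one_lt_rpow hlt hp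
          have h3 : proj p x j ^ p ≤ ∑ i, proj p x i ^ p :=
            Finset.single_le_sum (f := fun i => proj p x i ^ p)
              (fun i _ => Real.rpow_nonneg (h0 i) p) (Finset.mem_univ j)
          linarith
      _ = volume (ball p n 1) := by simp
  have hN := mul_norm_identity hp hn hh hh0 hfin
  have hN' : ∫⁻ x in ball p n 1, F (proj p x) * ENNReal.ofReal (q p x ^ (1 / p))
      = ∫⁻ x in ball p n 1, F x := by
    refine setLIntegral_congr_fun (ball_meas p n 1) fun x hx => ?_
    have hq := q_pos p hn hx.1
    have := hF1 (q p x ^ (1 / p)) (by positivity) (proj p x)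
      ((orth_smul (by positivity)).2 hx.1)
    rw [smul_proj hn hx.1, pow_one] at this
    rw [this, mul_comm]
  rw [hN'] at hN
  have hI : ∫⁻ x, F x ∂μ = (volume (ball p n 1))⁻¹ * ∫⁻ x in ball p n 1, F (proj p x) := by
    rw [cone_eq hp hn hμ, lintegral_smul_measure, lintegral_map hF (proj_meas p n), smul_eq_mul]
  have hE := iid_lintegral hp hn hF hF1
  have hV := ball_volume hp hn
  have hnn : ∀ x : Fin n → ℝ, 0 ≤ kthMax x m := fun x => kth_nonneg x hm1 hm
  rw [integral_eq_lintegral_of_nonneg_ae (Filter.Eventually.of_forall hnn)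
      hg.aestronglyMeasurable,
    integral_eq_lintegral_of_nonneg_ae (Filter.Eventually.of_forall hnn)
      hg.aestronglyMeasurable]
  change (∫⁻ x, F x ∂μ).toReal = _ * (∫⁻ x, F x ∂(iidExp p n)).toReal
  rw [hI, hE, hN]
  have hc := c_pos hp
  have hn0 : (0 : ℝ) < n := by
    have : 0 < n := by omega
    exact_mod_cast this
  have hx1 : 0 < (n : ℝ) / p := by positivity
  have hx2 : 0 < (n : ℝ) / p + 1 / p := by positivity
  have g1 := Real.Gamma_pos_of_pos hx1
  have g2 := Real.Gamma_pos_of_pos hx2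
  have e2 : ((n : ℝ) + (1 : ℕ)) / p = n / p + 1 / p := by push_cast; ring
  rw [e2, Real.Gamma_add_one hx2.ne']
  rw [Real.Gamma_add_one hx1.ne'] at hV
  have hV' := congrArg ENNReal.toReal hV
  simp only [ENNReal.toReal_mul, ENNReal.toReal_one, ENNReal.toReal_inv] at hV' ⊢
  rw [ENNReal.toReal_ofReal (by positivity), ENNReal.toReal_ofReal (by positivity)] at hV'
  rw [ENNReal.toReal_ofReal (by positivity), ENNReal.toReal_ofReal (by positivity),
    ENNReal.toReal_ofReal (by positivity)]
  have hv0 : 0 < (volume (ball p n 1)).toReal := ENNReal.toReal_pos hb0 hb1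
  set v := (volume (ball p n 1)).toReal
  set H := (∫⁻ x in ball p n 1, F (proj p x)).toReal
  set c := (p / Real.Gamma (1 / p)) ^ n
  set G1 := Real.Gamma (n / p)
  set G2 := Real.Gamma (n / p + 1 / p)
  have hci : c = (n / p * G1 * v)⁻¹ := by
    exact eq_inv_of_mul_eq_one_left hV'
  rw [hci]
  field_simp

end ConeAux

/-- For `0 < p < ∞`, `n ≥ 2`, `1 ≤ m ≤ n`:
`∫_{Δ_p^n} x_m^* dμ_p(x) = (Γ(n/p)/Γ(n/p + 1/p)) E[ω_m^*]`, and there are constants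
`C_p^1, C_p^2 > 0` depending only on `p` with
`C_p^1 E[ω_m^*]/n^{1/p} ≤ ∫_{Δ_p^n} x_m^* dμ_p(x) ≤ C_p^2 E[ω_m^*]/n^{1/p}`. -/
theorem cone_measure_kth_max_integral (p : ℝ) (hp : 0 < p) :
    (∀ n : ℕ, 2 ≤ n → ∀ m : ℕ, 1 ≤ m → m ≤ n →
      ∀ μ : Measure (Fin n → ℝ), IsConeMeasure p n μ →
        ∫ x, kthMax x m ∂μ
          = (Real.Gamma (n / p) / Real.Gamma (n / p + 1 / p)) *
              ∫ ω, kthMax ω m ∂(iidExp p n)) ∧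
    (∃ C₁ C₂ : ℝ, 0 < C₁ ∧ 0 < C₂ ∧
      ∀ n : ℕ, 2 ≤ n → ∀ m : ℕ, 1 ≤ m → m ≤ n →
        ∀ μ : Measure (Fin n → ℝ), IsConeMeasure p n μ →
          C₁ * ((∫ ω, kthMax ω m ∂(iidExp p n)) / (n : ℝ) ^ (1 / p)) ≤ ∫ x, kthMax x m ∂μ ∧
          ∫ x, kthMax x m ∂μ
            ≤ C₂ * ((∫ ω, kthMax ω m ∂(iidExp p n)) / (n : ℝ) ^ (1 / p))) := by
  refine ⟨fun n hn m hm1 hm μ hμ => ConeAux.main_eq hp hn hm1 hm hμ,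
    (p / 2) ^ (1 / p), 2 * p ^ (1 / p), by positivity, by positivity, ?_⟩
  intro n hn m hm1 hm μ hμ
  rw [ConeAux.main_eq hp hn hm1 hm hμ]
  obtain ⟨h1, h2⟩ := ConeAux.ratio_bounds hp hn
  have hE : 0 ≤ ∫ ω, kthMax ω m ∂(iidExp p n) :=
    integral_nonneg fun x => ConeAux.kth_nonneg x hm1 hm
  constructor
  · rw [mul_div_assoc', mul_div_right_comm]
    exact mul_le_mul_of_nonneg_right h1 hE
  · rw [mul_div_assoc', mul_div_right_comm]
    exact mul_le_mul_of_nonneg_right h2 hE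

end
end

section
/- Let α ∈ ℝ and δ > 0. Then ∫_δ^∞ u^α e^{−u} du ≤ δ^α e^{−δ} if α ≤ 0; ∫_δ^∞ u^α e^{−u} du ≤ δ^α e^{−δ} · 1/(1−α/δ) if α > 0 and α/δ < 1; and ∫_δ^∞ u^α e^{−u} du ≤ δ^α e^{−δ} · (α/δ)^α · (α/δ)/(1−δ/α) if α > 0 and α/δ > 1. -/
open MeasureTheory Real Set

noncomputable section

/-- Tangent bound for the power function. -/
lemma aux_tangent (α T u : ℝ) (hα : 0 ≤ α) (hT : 0 < T) (hu : 0 < u) :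
    u ^ α ≤ T ^ α * Real.exp (α * (u / T - 1)) := by
  have h : Real.log u ≤ Real.log T + (u / T - 1) := by
    have h1 := Real.log_le_sub_one_of_pos (div_pos hu hT)
    rw [Real.log_div hu.ne' hT.ne'] at h1
    linarith
  rw [Real.rpow_def_of_pos hu, Real.rpow_def_of_pos hT, ← Real.exp_add]
  apply Real.exp_le_exp.mpr
  nlinarith [mul_le_mul_of_nonneg_left h hα]

lemma aux_tail (α T : ℝ) (hα : 0 ≤ α) (hT : 0 < T) (h : α / T < 1) :
    (∫ u in Ioi T, u ^ α * Real.exp (-u)) ≤ T ^ α * Real.exp (-T) * (1 / (1 - α / T)) := by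
  have hc : α / T - 1 < 0 := by linarith
  have key : (∫ u in Ioi T, u ^ α * Real.exp (-u)) ≤
      ∫ u in Ioi T, (T ^ α * Real.exp (-α)) * Real.exp ((α / T - 1) * u) := by
    apply integral_mono_of_nonneg
    · filter_upwards [ae_restrict_mem measurableSet_Ioi] with u hu
      have hu0 : 0 < u := hT.trans hu
      show 0 ≤ u ^ α * Real.exp (-u)
      positivity
    · exact (integrableOn_exp_mul_Ioi hc T).const_mul _
    · filter_upwards [ae_restrict_mem measurableSet_Ioi] with u hu
      have hu0 : 0 < u := hT.trans hu
      have h1 := mul_le_mul_of_nonneg_right (aux_tangent α T u hα hT hu0) (Real.exp_pos (-u)).le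
      refine h1.trans (le_of_eq ?_)
      rw [mul_assoc, mul_assoc, ← Real.exp_add, ← Real.exp_add]
      congr 2
      field_simp
      ring
  refine key.trans (le_of_eq ?_)
  rw [integral_const_mul, integral_exp_mul_Ioi hc]
  have e : (α / T - 1) * T = α + -T := by field_simp; ring
  have h2 : Real.exp (-α) * Real.exp (α + -T) = Real.exp (-T) := by
    rw [← Real.exp_add]; congr 1; ring
  have h3 : α / T - 1 = -(1 - α / T) := by ring
  rw [e, h3, neg_div_neg_eq, ← h2]
  ring

lemma aux_mid (α δ : ℝ) (hα : 0 < α) (hδ : 0 < δ) (h : δ < α) :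
    (∫ u in Ioi δ, u ^ α * Real.exp (-u))
      ≤ δ ^ α * Real.exp (-δ) * ((α / δ) ^ α * ((α / δ) / (1 - δ / α))) := by
  obtain ⟨T, hTdef⟩ : ∃ T, T = α * (α / δ) := ⟨_, rfl⟩
  have hx : 1 < α / δ := (one_lt_div hδ).mpr h
  have hαT : α < T := by rw [hTdef]; nlinarith
  have hT : 0 < T := hα.trans hαT
  have hδT : δ < T := h.trans hαT
  have hr : α / T = δ / α := by rw [hTdef]; field_simp
  have hint : IntegrableOn (fun u : ℝ => u ^ α * Real.exp (-u)) (Ioi 0) := by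
    have h1 := Real.GammaIntegral_convergent (s := α + 1) (by linarith)
    simpa [mul_comm] using h1
  have hs : δ / α < 1 := (div_lt_one hα).mpr h
  have hs0 : 0 < δ / α := by positivity
  have hsplit : (∫ u in Ioi δ, u ^ α * Real.exp (-u)) =
      (∫ u in Ioc δ T, u ^ α * Real.exp (-u)) + ∫ u in Ioi T, u ^ α * Real.exp (-u) := by
    rw [← Ioc_union_Ioi_eq_Ioi hδT.le]
    apply setIntegral_union (Ioc_disjoint_Ioi le_rfl) measurableSet_Ioi
    · exact hint.mono_set (fun u hu => hδ.trans hu.1)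
    · exact hint.mono_set (fun u hu => hT.trans hu)
  have hA : (∫ u in Ioc δ T, u ^ α * Real.exp (-u)) ≤ α ^ α * Real.exp (-δ) * (α / δ) := by
    have h1 : (∫ u in Ioc δ T, u ^ α * Real.exp (-u)) ≤
        ∫ u in Ioc δ T, α ^ α * Real.exp (-α) := by
      apply setIntegral_mono_on (hint.mono_set (fun u hu => hδ.trans hu.1)) _ measurableSet_Ioc
      · intro u hu
        have hu0 : 0 < u := hδ.trans hu.1
        have h1 := mul_le_mul_of_nonneg_right (aux_tangent α α u hα.le hα hu0)
          (Real.exp_pos (-u)).le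
        refine h1.trans (le_of_eq ?_)
        rw [mul_assoc, ← Real.exp_add]
        congr 2
        field_simp
        ring
      · exact integrableOn_const (by simp)
    refine h1.trans ?_
    have h2 : (∫ u in Ioc δ T, α ^ α * Real.exp (-α)) = (T - δ) * (α ^ α * Real.exp (-α)) := by
      rw [setIntegral_const, smul_eq_mul, Real.volume_real_Ioc_of_le hδT.le]
    rw [h2]
    have h3 : Real.exp (-δ) = Real.exp (-α) * Real.exp (α - δ) := by
      rw [← Real.exp_add]; congr 1; ring
    have h4 : 2 * (α - δ) ≤ Real.exp (α - δ) := by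
      have h5 := Real.add_one_le_exp (α - δ - 1)
      have h6 : Real.exp (α - δ) = Real.exp 1 * Real.exp (α - δ - 1) := by
        rw [← Real.exp_add]; congr 1; ring
      have h7 : 2 ≤ Real.exp 1 := by linarith [Real.add_one_le_exp (1:ℝ)]
      rw [h6]
      exact mul_le_mul h7 (by linarith) (by linarith) (by positivity)
    have h5 : T - δ ≤ Real.exp (α - δ) * (α / δ) := by
      have e1 : T - δ = (α - δ) * (1 + δ / α) * (α / δ) := by
        rw [hTdef]; field_simp; ring
      rw [e1]
      apply mul_le_mul_of_nonneg_right _ (by positivity)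
      nlinarith
    rw [h3]
    have h6 : 0 ≤ α ^ α * Real.exp (-α) := by positivity
    nlinarith [mul_le_mul_of_nonneg_left h5 h6]
  have hB : (∫ u in Ioi T, u ^ α * Real.exp (-u)) ≤
      α ^ α * Real.exp (-δ) * (1 / (1 - δ / α)) := by
    have h1 := aux_tail α T hα.le hT (by rw [hr]; exact hs)
    rw [hr] at h1
    refine h1.trans ?_
    apply mul_le_mul_of_nonneg_right _ (by apply one_div_nonneg.mpr; linarith)
    have h2 := mul_le_mul_of_nonneg_right (aux_tangent α α T hα.le hα hT) (Real.exp_pos (-T)).le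
    refine h2.trans ?_
    rw [mul_assoc, ← Real.exp_add]
    apply mul_le_mul_of_nonneg_left _ (by positivity)
    apply Real.exp_le_exp.mpr
    have e : α * (T / α - 1) = T - α := by field_simp
    linarith
  rw [hsplit]
  refine (add_le_add hA hB).trans (le_of_eq ?_)
  have e : δ ^ α * (α / δ) ^ α = α ^ α := by
    rw [← Real.mul_rpow hδ.le (by positivity)]
    congr 1
    field_simp
  rw [← e]
  have h1 : α - δ ≠ 0 := by linarith
  have h2 : α / δ + 1 / (1 - δ / α) = (α / δ) / (1 - δ / α) := by
    have h3 : 1 - δ / α ≠ 0 := by linarith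
    rw [eq_div_iff h3, add_mul, div_mul_cancel₀ _ h3]
    field_simp
    ring
  rw [← h2]
  ring

/-- For `α ∈ ℝ` and `δ > 0`:
`∫_δ^∞ u^α e^{-u} du ≤ δ^α e^{-δ}` if `α ≤ 0`;
`∫_δ^∞ u^α e^{-u} du ≤ δ^α e^{-δ} / (1 - α/δ)` if `α > 0` and `α/δ < 1`;
`∫_δ^∞ u^α e^{-u} du ≤ δ^α e^{-δ} (α/δ)^α (α/δ)/(1 - δ/α)` if `α > 0` and `α/δ > 1`. -/
theorem incomplete_gamma_tail_bounds (α δ : ℝ) (hδ : 0 < δ) :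
    (α ≤ 0 → (∫ u in Ioi δ, u ^ α * Real.exp (-u)) ≤ δ ^ α * Real.exp (-δ)) ∧
    (0 < α → α / δ < 1 →
      (∫ u in Ioi δ, u ^ α * Real.exp (-u))
        ≤ δ ^ α * Real.exp (-δ) * (1 / (1 - α / δ))) ∧
    (0 < α → 1 < α / δ →
      (∫ u in Ioi δ, u ^ α * Real.exp (-u))
        ≤ δ ^ α * Real.exp (-δ) * ((α / δ) ^ α * ((α / δ) / (1 - δ / α)))) := by
  refine ⟨fun hα => ?_, fun hα h => aux_tail α δ hα.le hδ h,
    fun hα h => aux_mid α δ hα hδ ((one_lt_div hδ).mp h)⟩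
  have key : (∫ u in Ioi δ, u ^ α * Real.exp (-u)) ≤
      ∫ u in Ioi δ, δ ^ α * Real.exp (-1 * u) := by
    apply integral_mono_of_nonneg
    · filter_upwards [ae_restrict_mem measurableSet_Ioi] with u hu
      have hu0 : 0 < u := hδ.trans hu
      show 0 ≤ u ^ α * Real.exp (-u)
      positivity
    · exact (integrableOn_exp_mul_Ioi (by norm_num) δ).const_mul _
    · filter_upwards [ae_restrict_mem measurableSet_Ioi] with u hu
      have h1 := Real.rpow_le_rpow_of_nonpos hδ (le_of_lt hu) hα
      rw [neg_one_mul]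
      exact mul_le_mul_of_nonneg_right h1 (Real.exp_pos (-u)).le
  refine key.trans (le_of_eq ?_)
  rw [integral_const_mul, integral_exp_mul_Ioi (by norm_num)]
  simp

end
end

section
/- Let 0<p<∞. Then there is a positive real number C_p depending only on p such that E[ω_m*] ≤ C_p · (log(en/m))^{1/p} for all natural numbers n ≥ 2 and 1 ≤ m ≤ n. -/
open MeasureTheory Real Set
open scoped ENNReal

noncomputable section

lemma integrableOn_aux (p : ℝ) (hp : 0 < p) :
    Integrable (fun t : ℝ => |t| * Real.exp (|t| ^ p / 2)) (expMeasure p) := by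
  unfold expMeasure
  rw [integrable_withDensity_iff_integrable_smul' (by fun_prop)
    (by filter_upwards with x using ENNReal.ofReal_lt_top)]
  have h := integrableOn_rpow_mul_exp_neg_mul_rpow (s := 1) (p := p) (b := 1 / 2)
    (by norm_num) hp (by norm_num)
  have h2 : IntegrableOn (fun t : ℝ => (p / Real.Gamma (1 / p)) *
      (t ^ (1 : ℝ) * Real.exp (-(1 / 2) * t ^ p))) (Ioi 0) := h.const_mul _
  refine IntegrableOn.congr_fun h2 ?_ measurableSet_Ioi
  intro t ht
  have ht' : 0 < t := ht
  have hG : 0 < Real.Gamma (1 / p) := Real.Gamma_pos_of_pos (by positivity)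
  have h0 : 0 ≤ (p / Real.Gamma (1 / p)) * Real.exp (-(t ^ p)) := by positivity
  simp only [ENNReal.toReal_ofReal h0, smul_eq_mul, abs_of_pos ht', Real.rpow_one]
  have : Real.exp (-(1 / 2) * t ^ p) = Real.exp (-(t ^ p)) * Real.exp (t ^ p / 2) := by
    rw [← Real.exp_add]; congr 1; ring
  rw [this]; ring

lemma isProb_expMeasure (p : ℝ) (hp : 0 < p) : IsProbabilityMeasure (expMeasure p) := by
  constructor
  have hG : 0 < Real.Gamma (1 / p) := Real.Gamma_pos_of_pos (by positivity)
  have h := integrableOn_rpow_mul_exp_neg_mul_rpow (s := 0) (p := p) (b := 1)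
    (by norm_num) hp (by norm_num)
  have h1 : IntegrableOn (fun t : ℝ => (p / Real.Gamma (1 / p)) * Real.exp (-(t ^ p)))
      (Ioi 0) := by
    have := h.const_mul (p / Real.Gamma (1 / p))
    simpa [IntegrableOn] using this
  unfold expMeasure
  rw [withDensity_apply _ MeasurableSet.univ, Measure.restrict_univ,
    ← ofReal_integral_eq_lintegral_ofReal h1
      (by filter_upwards with t; simp only [Pi.zero_apply]; positivity),
    integral_const_mul, integral_exp_neg_rpow hp, Real.Gamma_add_one (by positivity)]
  have : p / Real.Gamma (1 / p) * (1 / p * Real.Gamma (1 / p)) = 1 := by field_simp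
  rw [this, ENNReal.ofReal_one]

lemma kthMax_nonneg_aux {n m : ℕ} (hmn : m ≤ n) (x : Fin n → ℝ) : 0 ≤ kthMax x m := by
  unfold kthMax
  apply Real.sSup_nonneg'
  exact ⟨0, ⟨Finset.univ, by simpa using hmn, fun j _ => abs_nonneg _⟩, le_rfl⟩

lemma kthMax_le_aux {n m : ℕ} (p : ℝ) (hp : 0 < p) (hm : 1 ≤ m) (hmn : m ≤ n)
    (x : Fin n → ℝ) :
    kthMax x m ≤ (2 * Real.log (Real.exp 1 * n / m)) ^ (1 / p)
      + ∑ j, (1 / (Real.exp 1 * n)) * (|x j| * Real.exp (|x j| ^ p / 2)) := by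
  have hm0 : (0 : ℝ) < m := by exact_mod_cast hm
  have hn0 : (0 : ℝ) < n := by exact_mod_cast (by omega : 0 < n)
  have hmn' : (m : ℝ) ≤ n := by exact_mod_cast hmn
  set L := Real.log (Real.exp 1 * n / m) with hL
  have hexpL : Real.exp L = Real.exp 1 * n / m := Real.exp_log (by positivity)
  have hL0 : 0 ≤ L := by
    apply Real.log_nonneg
    rw [le_div_iff₀ hm0]
    have : (1 : ℝ) ≤ Real.exp 1 := Real.one_le_exp (by norm_num)
    nlinarith
  have hT0 : 0 ≤ (2 * L) ^ (1 / p) := by positivity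
  have hTp : ((2 * L) ^ (1 / p)) ^ p = 2 * L := by
    rw [← Real.rpow_mul (by positivity), one_div_mul_cancel hp.ne', Real.rpow_one]
  set T := (2 * L) ^ (1 / p) with hT
  have hsum : 0 ≤ ∑ j, (1 / (Real.exp 1 * n)) * (|x j| * Real.exp (|x j| ^ p / 2)) :=
    Finset.sum_nonneg fun j _ => by positivity
  unfold kthMax
  refine csSup_le ⟨0, Finset.univ, by simpa using hmn, fun j _ => abs_nonneg _⟩ ?_
  rintro t ⟨S, hS, ht⟩
  rcases le_or_gt t T with h | h
  · linarith
  have ht0 : 0 ≤ t := hT0.trans h.le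
  have hS' : (m : ℝ) ≤ S.card := by exact_mod_cast hS
  have h1 : ∀ j ∈ S, t / m ≤ (1 / (Real.exp 1 * n)) * (|x j| * Real.exp (|x j| ^ p / 2)) := by
    intro j hj
    have h2 : L ≤ |x j| ^ p / 2 := by
      have := Real.rpow_le_rpow hT0 (h.le.trans (ht j hj)) hp.le
      rw [hTp] at this
      linarith
    have h3 : t * Real.exp L ≤ |x j| * Real.exp (|x j| ^ p / 2) := by
      have := ht j hj
      gcongr
    calc t / m = (1 / (Real.exp 1 * n)) * (t * Real.exp L) := by rw [hexpL]; field_simp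
      _ ≤ _ := by gcongr
  have h4 : t ≤ ∑ j ∈ S, (1 / (Real.exp 1 * n)) * (|x j| * Real.exp (|x j| ^ p / 2)) := by
    calc t = m * (t / m) := by field_simp
      _ ≤ S.card * (t / m) := by gcongr
      _ = ∑ j ∈ S, t / m := by simp
      _ ≤ _ := Finset.sum_le_sum h1
  have h5 : ∑ j ∈ S, (1 / (Real.exp 1 * n)) * (|x j| * Real.exp (|x j| ^ p / 2)) ≤
      ∑ j, (1 / (Real.exp 1 * n)) * (|x j| * Real.exp (|x j| ^ p / 2)) :=
    Finset.sum_le_sum_of_subset_of_nonneg (Finset.subset_univ _) fun j _ _ => by positivity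
  linarith

/-- For `0 < p < ∞` there is `C_p > 0` (depending only on `p`) such that
`E[ω_m^*] ≤ C_p (log(e n / m))^{1/p}` for all `n ≥ 2` and `1 ≤ m ≤ n`. -/
theorem expected_kth_max_upper (p : ℝ) (hp : 0 < p) :
    ∃ C : ℝ, 0 < C ∧ ∀ n m : ℕ, 2 ≤ n → 1 ≤ m → m ≤ n →
      ∫ ω, kthMax ω m ∂(iidExp p n)
        ≤ C * (Real.log (Real.exp 1 * n / m)) ^ (1 / p) := by
  have := isProb_expMeasure p hp
  have hgi := integrableOn_aux p hp
  set g : ℝ → ℝ := fun t => |t| * Real.exp (|t| ^ p / 2) with hg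
  set K := ∫ t, g t ∂(expMeasure p) with hK
  have hK0 : 0 ≤ K := integral_nonneg fun t => by simp only [hg, Pi.zero_apply]; positivity
  refine ⟨2 ^ (1 / p) + K, by positivity, ?_⟩
  intro n m hn hm hmn
  have hm0 : (0 : ℝ) < m := by exact_mod_cast hm
  have hn0 : (0 : ℝ) < n := by exact_mod_cast (by omega : 0 < n)
  have hmn' : (m : ℝ) ≤ n := by exact_mod_cast hmn
  have hL1 : 1 ≤ Real.log (Real.exp 1 * n / m) := by
    rw [Real.le_log_iff_exp_le (by positivity), le_div_iff₀ hm0]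
    gcongr
  have hprob : IsProbabilityMeasure (iidExp p n) := by unfold iidExp; infer_instance
  have hmp : ∀ j : Fin n, MeasurePreserving (fun ω : Fin n → ℝ => ω j) (iidExp p n)
      (expMeasure p) := fun j => measurePreserving_eval (fun _ => expMeasure p) j
  have hint : ∀ j : Fin n, Integrable (fun ω : Fin n → ℝ => g (ω j)) (iidExp p n) :=
    fun j => (hmp j).integrable_comp_of_integrable hgi
  have hval : ∀ j : Fin n, ∫ ω, g (ω j) ∂(iidExp p n) = K := by
    intro j
    rw [hK, ← (hmp j).map_eq, integral_map (hmp j).measurable.aemeasurable]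
    rw [(hmp j).map_eq]; exact hgi.aestronglyMeasurable
  have hs : Integrable (fun ω : Fin n → ℝ => ∑ j, (1 / (Real.exp 1 * n)) * g (ω j))
      (iidExp p n) := integrable_finsetSum _ fun j _ => (hint j).const_mul _
  have key := integral_mono_of_nonneg (μ := iidExp p n)
    (f := fun ω => kthMax ω m)
    (g := fun ω => (2 * Real.log (Real.exp 1 * n / m)) ^ (1 / p)
      + ∑ j, (1 / (Real.exp 1 * n)) * g (ω j))
    (Filter.Eventually.of_forall fun ω => kthMax_nonneg_aux hmn ω)
    ((integrable_const _).add hs)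
    (Filter.Eventually.of_forall fun ω => kthMax_le_aux p hp hm hmn ω)
  refine key.trans ?_
  rw [integral_add (integrable_const _) hs,
    integral_finsetSum _ fun j _ => (hint j).const_mul _]
  simp only [integral_const_mul, hval, integral_const, probReal_univ, one_smul, Finset.sum_const,
    Finset.card_univ, Fintype.card_fin, nsmul_eq_mul]
  rw [Real.mul_rpow (by norm_num) (by linarith), add_mul]
  have h1 : 1 ≤ Real.log (Real.exp 1 * n / m) ^ (1 / p) := Real.one_le_rpow hL1 (by positivity)
  have h2 : (n : ℝ) * (1 / (Real.exp 1 * n) * K) = K / Real.exp 1 := by field_simp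
  have h3 : K / Real.exp 1 ≤ K := div_le_self hK0 (Real.one_le_exp (by norm_num))
  rw [h2]
  nlinarith

end
end

section
/- Let 0<p<∞ and n ≥ 2. There is a positive real number C_p depending only on p such that for all 0 ≤ m ≤ n−1, σ_m^{p,∞}(μ_p) = ∫_{Δ_p^n} x_{m+1}* dμ_p(x) ≤ C_p · (log(en/(m+1))/n)^{1/p}. -/
open MeasureTheory Real Set
open scoped ENNReal

noncomputable section

/-- The positive part of the `ℓ_p` ball `{∑ x_i^p ≤ s}`. -/
def DD (p : ℝ) (n : ℕ) (s : ℝ) : Set (Fin n → ℝ) :=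
  {x | (∀ i, 0 ≤ x i) ∧ ∑ i, x i ^ p ≤ s}

lemma measurable_N (p : ℝ) (n : ℕ) : Measurable (fun x : Fin n → ℝ => ∑ i, x i ^ p) := by
  fun_prop

lemma measurableSet_orth (n : ℕ) : MeasurableSet {x : Fin n → ℝ | ∀ i, 0 ≤ x i} := by
  simp only [ofPred_forall]
  exact MeasurableSet.iInter fun i => measurableSet_le measurable_const (measurable_pi_apply i)

lemma measurableSet_DD (p : ℝ) (n : ℕ) (s : ℝ) : MeasurableSet (DD p n s) :=
  (measurableSet_orth n).inter (measurableSet_le (measurable_N p n) measurable_const)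

lemma measurableSet_Delta (p : ℝ) (n : ℕ) : MeasurableSet (Delta p n) :=
  (measurableSet_orth n).inter (measurableSet_eq_fun (measurable_N p n) measurable_const)

lemma N_smul (p : ℝ) (n : ℕ) (r : ℝ) (hr : 0 ≤ r) (x : Fin n → ℝ) (hx : ∀ i, 0 ≤ x i) :
    ∑ i, (r • x) i ^ p = r ^ p * ∑ i, x i ^ p := by
  rw [Finset.mul_sum]
  refine Finset.sum_congr rfl fun i _ => ?_
  rw [Pi.smul_apply, smul_eq_mul, Real.mul_rpow hr (hx i)]

lemma smul_mem_DD_iff (p : ℝ) (n : ℕ) (r : ℝ) (hr : 0 < r) (x : Fin n → ℝ) :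
    r • x ∈ DD p n (r ^ p) ↔ x ∈ DD p n 1 := by
  have h1 : (∀ i, 0 ≤ (r • x) i) ↔ ∀ i, 0 ≤ x i := by
    refine forall_congr' fun i => ?_
    rw [Pi.smul_apply, smul_eq_mul, mul_nonneg_iff_of_pos_left hr]
  unfold DD
  simp only [mem_ofPred_eq]
  rw [h1]
  refine and_congr_right fun hx => ?_
  rw [N_smul p n r hr.le x hx]
  have : 0 < r ^ p := Real.rpow_pos_of_pos hr p
  constructor
  · intro h; by_contra hc; push Not at hc; nlinarith
  · intro h; nlinarith

lemma setLIntegral_DD_scale (p : ℝ) (n : ℕ) (r : ℝ) (hr : 0 < r) (f : (Fin n → ℝ) → ℝ≥0∞)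
    (hf : Measurable f) :
    ∫⁻ x in DD p n (r ^ p), f x = ENNReal.ofReal (r ^ n) * ∫⁻ x in DD p n 1, f (r • x) := by
  have hm := Measure.map_addHaar_smul (volume : Measure (Fin n → ℝ)) hr.ne'
  rw [Module.finrank_fin_fun] at hm
  have h2 : ∫⁻ x, (DD p n (r ^ p)).indicator f (r • x)
      = ENNReal.ofReal |(r ^ n)⁻¹| * ∫⁻ x in DD p n (r ^ p), f x := by
    rw [← lintegral_indicator (measurableSet_DD p n _)]
    rw [← lintegral_map (hf.indicator (measurableSet_DD p n _)) (measurable_const_smul r), hm,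
      lintegral_smul_measure, smul_eq_mul]
  have h3 : ∫⁻ x, (DD p n (r ^ p)).indicator f (r • x) = ∫⁻ x in DD p n 1, f (r • x) := by
    rw [← lintegral_indicator (measurableSet_DD p n _)]
    refine lintegral_congr fun x => ?_
    by_cases hx : x ∈ DD p n 1
    · rw [indicator_of_mem hx, indicator_of_mem ((smul_mem_DD_iff p n r hr x).2 hx)]
    · rw [indicator_of_notMem hx,
        indicator_of_notMem (fun h => hx ((smul_mem_DD_iff p n r hr x).1 h))]
  rw [← h3, h2, ← mul_assoc, ← ENNReal.ofReal_mul (by positivity),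
    abs_of_pos (by positivity : 0 < (r ^ n)⁻¹), mul_inv_cancel₀ (by positivity),
    ENNReal.ofReal_one, one_mul]

lemma one_dim (p c : ℝ) (hp : 0 < p) (hc : 0 ≤ c) :
    IntegrableOn (fun t : ℝ => t ^ c * Real.exp (-t ^ p)) (Ici 0) ∧
      ∫ t in Ici (0 : ℝ), t ^ c * Real.exp (-t ^ p) = (1 / p) * Real.Gamma ((c + 1) / p) := by
  have h := integral_rpow_mul_exp_neg_rpow hp (by linarith : -1 < c)
  rw [integrableOn_Ici_iff_integrableOn_Ioi, integral_Ici_eq_integral_Ioi]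
  refine ⟨?_, h⟩
  by_contra hn
  have h0 := integral_undef hn
  rw [h] at h0
  have : 0 < (1 / p) * Real.Gamma ((c + 1) / p) :=
    mul_pos (by positivity) (Real.Gamma_pos_of_pos (by positivity))
  linarith

lemma gauss_int (p : ℝ) (hp : 0 < p) (n : ℕ) (j : Fin n) (l : ℕ) :
    ∫⁻ x in {x : Fin n → ℝ | ∀ i, 0 ≤ x i},
        ENNReal.ofReal (x j ^ (p * l) * Real.exp (-∑ i, x i ^ p))
      = ENNReal.ofReal ((1 / p * Real.Gamma (1 / p + l)) *
          (1 / p * Real.Gamma (1 / p)) ^ (n - 1)) := by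
  classical
  have hset : {x : Fin n → ℝ | ∀ i, 0 ≤ x i} = Set.univ.pi fun _ => Ici (0 : ℝ) := by
    ext x; simp [Pi.le_def]
  let e : Fin n → ℝ := fun i => if i = j then p * l else 0
  have he : ∀ i, 0 ≤ e i := by
    intro i; simp only [e]; split_ifs <;> positivity
  let g : Fin n → ℝ → ℝ := fun i t => t ^ e i * Real.exp (-t ^ p)
  have hprod : ∀ x : Fin n → ℝ, x j ^ (p * l) * Real.exp (-∑ i, x i ^ p) = ∏ i, g i (x i) := by
    intro x
    simp only [g, Finset.prod_mul_distrib, ← Real.exp_sum, Finset.sum_neg_distrib]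
    congr 1
    rw [Finset.prod_eq_single j]
    · simp [e]
    · intro b _ hb; simp [e, hb]
    · simp
  rw [hset, volume_pi, Measure.restrict_pi_pi]
  simp_rw [hprod]
  rw [← ofReal_integral_eq_lintegral_ofReal]
  · rw [integral_fintype_prod_eq_prod]
    congr 1
    rw [← Finset.mul_prod_erase _ _ (Finset.mem_univ j)]
    congr 1
    · rw [(one_dim p (e j) hp (he j)).2]
      simp only [e, if_true]
      congr 2; field_simp; ring
    · rw [Finset.prod_congr rfl (g := fun _ => 1 / p * Real.Gamma (1 / p))]
      · simp
      · intro i hi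
        rw [(one_dim p (e i) hp (he i)).2]
        simp [e, Finset.ne_of_mem_erase hi]
  · exact Integrable.fintype_prod (fun i => (one_dim p (e i) hp (he i)).1)
  · have : ∀ᵐ x ∂(Measure.pi fun _ : Fin n => (volume : Measure ℝ).restrict (Ici 0)),
        ∀ i, 0 ≤ x i := by
      rw [← Measure.restrict_pi_pi, ← hset]
      exact ae_restrict_mem (measurableSet_orth n)
    filter_upwards [this] with x hx
    exact Finset.prod_nonneg fun i _ => mul_nonneg (Real.rpow_nonneg (hx i) _) (Real.exp_nonneg _)

lemma exp_layer (a : ℝ) (ha : 0 ≤ a) :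
    ENNReal.ofReal (Real.exp (-a)) =
      ∫⁻ s in Ioi (0 : ℝ), if a ≤ s then ENNReal.ofReal (Real.exp (-s)) else 0 := by
  have h1 : ∫⁻ s in Ioi (0 : ℝ), (if a ≤ s then ENNReal.ofReal (Real.exp (-s)) else 0)
      = ∫⁻ s in Ioi a, ENNReal.ofReal (Real.exp (-s)) := by
    rw [restrict_Ioi_eq_restrict_Ici, ← lintegral_indicator measurableSet_Ici,
      restrict_Ioi_eq_restrict_Ici, ← lintegral_indicator measurableSet_Ici]
    refine lintegral_congr fun s => ?_
    simp only [indicator, mem_Ici]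
    split_ifs <;> first | rfl | linarith
  rw [h1, ← ofReal_integral_eq_lintegral_ofReal, integral_exp_neg_Ioi]
  · exact exp_neg_integrableOn_Ioi a one_pos |>.congr_fun (fun x _ => by simp) measurableSet_Ioi
  · exact Filter.Eventually.of_forall fun x => Real.exp_nonneg _

lemma ball_int (p : ℝ) (hp : 0 < p) (n : ℕ) (j : Fin n) (l : ℕ) :
    ENNReal.ofReal (Real.Gamma (n / p + l + 1)) *
      ∫⁻ x in DD p n 1, ENNReal.ofReal (x j ^ (p * l))
      = ENNReal.ofReal ((1 / p * Real.Gamma (1 / p + l)) *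
          (1 / p * Real.Gamma (1 / p)) ^ (n - 1)) := by
  rw [← gauss_int p hp n j l]
  symm
  set O := {x : Fin n → ℝ | ∀ i, 0 ≤ x i} with hO
  set J := ∫⁻ x in DD p n 1, ENNReal.ofReal (x j ^ (p * l)) with hJ
  have hmeas : Measurable fun x : Fin n → ℝ => ENNReal.ofReal (x j ^ (p * l)) := by fun_prop
  calc ∫⁻ x in O, ENNReal.ofReal (x j ^ (p * l) * Real.exp (-∑ i, x i ^ p))
      = ∫⁻ x in O, ∫⁻ s in Ioi (0 : ℝ), ENNReal.ofReal (x j ^ (p * l)) *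
          (if ∑ i, x i ^ p ≤ s then ENNReal.ofReal (Real.exp (-s)) else 0) := by
        refine setLIntegral_congr_fun (measurableSet_orth n) fun x hx => ?_
        rw [ENNReal.ofReal_mul (Real.rpow_nonneg (hx j) _), exp_layer _
          (Finset.sum_nonneg fun i _ => Real.rpow_nonneg (hx i) _), lintegral_const_mul]
        exact Measurable.ite measurableSet_Ici (by fun_prop) (by fun_prop)
    _ = ∫⁻ s in Ioi (0 : ℝ), ∫⁻ x in O, ENNReal.ofReal (x j ^ (p * l)) *
          (if ∑ i, x i ^ p ≤ s then ENNReal.ofReal (Real.exp (-s)) else 0) := by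
        rw [lintegral_lintegral_swap]
        refine Measurable.aemeasurable ?_
        refine Measurable.mul (by fun_prop) ?_
        exact Measurable.ite (measurableSet_le (by fun_prop) (by fun_prop))
          (by fun_prop) (by fun_prop)
    _ = ∫⁻ s in Ioi (0 : ℝ), ENNReal.ofReal (Real.exp (-s) * s ^ (n / p + l + 1 - 1)) * J := by
        refine setLIntegral_congr_fun measurableSet_Ioi fun s hs => ?_
        have hs : 0 < s := hs
        have e1 : ∫⁻ x in O, ENNReal.ofReal (x j ^ (p * l)) *
            (if ∑ i, x i ^ p ≤ s then ENNReal.ofReal (Real.exp (-s)) else 0)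
            = ENNReal.ofReal (Real.exp (-s)) *
              ∫⁻ x in DD p n s, ENNReal.ofReal (x j ^ (p * l)) := by
          rw [← lintegral_const_mul _ hmeas, ← lintegral_indicator (measurableSet_orth n),
            ← lintegral_indicator (measurableSet_DD p n s)]
          refine lintegral_congr fun x => ?_
          simp only [indicator, DD, mem_ofPred_eq]
          by_cases h1 : ∀ i, 0 ≤ x i <;> by_cases h2 : ∑ i, x i ^ p ≤ s <;>
            simp [h1, h2, mul_comm]
        have hr : 0 < s ^ (1 / p) := Real.rpow_pos_of_pos hs _
        have hrs : (s ^ (1 / p)) ^ p = s := by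
          rw [← Real.rpow_mul hs.le, one_div_mul_cancel hp.ne', Real.rpow_one]
        have e2 : ∫⁻ x in DD p n s, ENNReal.ofReal (x j ^ (p * l))
            = ENNReal.ofReal (s ^ (n / p + l + 1 - 1)) * J := by
          have := setLIntegral_DD_scale p n _ hr _ hmeas
          rw [hrs] at this
          rw [this]
          have e3 : ∫⁻ x in DD p n 1, ENNReal.ofReal (((s ^ (1 / p)) • x) j ^ (p * l))
              = ENNReal.ofReal (s ^ (l : ℝ)) * J := by
            rw [hJ, ← lintegral_const_mul _ hmeas]
            refine setLIntegral_congr_fun (measurableSet_DD p n 1) fun x hx => ?_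
            rw [← ENNReal.ofReal_mul (by positivity), Pi.smul_apply, smul_eq_mul,
              Real.mul_rpow hr.le (hx.1 j), Real.rpow_mul hr.le, hrs]
          rw [e3, ← mul_assoc, ← ENNReal.ofReal_mul (by positivity), ← Real.rpow_natCast _ n,
            ← Real.rpow_mul hs.le, ← Real.rpow_add hs]
          congr 3; ring
        rw [e1, e2, ← mul_assoc, ← ENNReal.ofReal_mul (by positivity)]
    _ = ENNReal.ofReal (Real.Gamma (n / p + l + 1)) * J := by
        have hpos : 0 < n / p + l + 1 := by positivity
        rw [lintegral_mul_const _ (by fun_prop), Real.Gamma_eq_integral hpos,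
          ofReal_integral_eq_lintegral_ofReal (Real.GammaIntegral_convergent hpos)]
        refine (ae_restrict_mem measurableSet_Ioi).mono fun x hx => ?_
        exact mul_nonneg (Real.exp_nonneg _) (Real.rpow_nonneg (le_of_lt hx) _)

lemma Gamma_add_le (a : ℝ) (ha : 0 < a) (l k : ℕ) (hk : k ≤ l) :
    Real.Gamma (a + k) ≤ (a + l) ^ k * Real.Gamma a := by
  induction k with
  | zero => simp
  | succ k ih =>
    have h := ih (by omega)
    have hkl : (k : ℝ) ≤ l := by exact_mod_cast (by omega : k ≤ l)
    push_cast
    rw [← add_assoc, Real.Gamma_add_one (by positivity), pow_succ]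
    have := Real.Gamma_pos_of_pos ha
    calc (a + k) * Real.Gamma (a + k) ≤ (a + l) * ((a + l) ^ k * Real.Gamma a) := by
          gcongr
      _ = _ := by ring

lemma le_Gamma_add (b : ℝ) (hb : 0 < b) (k : ℕ) :
    b ^ k * Real.Gamma (b + 1) ≤ Real.Gamma (b + k + 1) := by
  induction k with
  | zero => simp
  | succ k ih =>
    push_cast
    rw [← add_assoc, Real.Gamma_add_one (s := b + k + 1) (by positivity), pow_succ]
    have := Real.Gamma_pos_of_pos (by positivity : 0 < b + k + 1)
    calc _ = b * (b ^ k * Real.Gamma (b + 1)) := by ring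
      _ ≤ (b + k + 1) * Real.Gamma (b + k + 1) := by
          gcongr
          have : (0 : ℝ) ≤ k := by positivity
          linarith

lemma eq_ofReal_div (g a : ℝ) (hg : 0 < g) (J : ℝ≥0∞)
    (h : ENNReal.ofReal g * J = ENNReal.ofReal a) : J = ENNReal.ofReal (a / g) := by
  rw [ENNReal.ofReal_div_of_pos hg, ← h, mul_comm, ENNReal.mul_div_cancel_right]
  · simpa using hg
  · exact ENNReal.ofReal_ne_top

lemma vol_DD (p : ℝ) (hp : 0 < p) (n : ℕ) (j : Fin n) :
    volume (DD p n 1) = ENNReal.ofReal (((1 / p * Real.Gamma (1 / p)) *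
          (1 / p * Real.Gamma (1 / p)) ^ (n - 1)) / Real.Gamma (n / p + 1)) := by
  have h := ball_int p hp n j 0
  simp only [Nat.cast_zero, mul_zero, Real.rpow_zero, ENNReal.ofReal_one, add_zero,
    setLIntegral_const, one_mul] at h
  exact eq_ofReal_div _ _ (Real.Gamma_pos_of_pos (by positivity)) _ h

lemma vol_DD_pos (p : ℝ) (hp : 0 < p) (n : ℕ) (j : Fin n) : volume (DD p n 1) ≠ 0 := by
  rw [vol_DD p hp n j]
  have h1 := Real.Gamma_pos_of_pos (by positivity : 0 < 1 / p)
  have h2 := Real.Gamma_pos_of_pos (by positivity : 0 < n / p + 1)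
  simp only [ne_eq, ENNReal.ofReal_eq_zero, not_le]
  positivity

lemma vol_DD_top (p : ℝ) (hp : 0 < p) (n : ℕ) (j : Fin n) : volume (DD p n 1) ≠ ⊤ := by
  rw [vol_DD p hp n j]
  exact ENNReal.ofReal_ne_top

lemma J_le (p : ℝ) (hp : 0 < p) (n : ℕ) (j : Fin n) (l : ℕ) :
    ∫⁻ x in DD p n 1, ENNReal.ofReal (x j ^ (p * l))
      ≤ ENNReal.ofReal (((1 + p * l) / n) ^ l) * volume (DD p n 1) := by
  have hn : (0 : ℝ) < n := by exact_mod_cast j.pos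
  rw [eq_ofReal_div _ _ (Real.Gamma_pos_of_pos (by positivity)) _ (ball_int p hp n j l),
    vol_DD p hp n j, ← ENNReal.ofReal_mul (by positivity)]
  apply ENNReal.ofReal_le_ofReal
  have h1 := Real.Gamma_pos_of_pos (by positivity : 0 < 1 / p)
  have h2 := Real.Gamma_pos_of_pos (by positivity : 0 < n / p + 1)
  have h3 := Real.Gamma_pos_of_pos (by positivity : 0 < n / p + l + 1)
  have h4 := Gamma_add_le (1 / p) (by positivity) l l le_rfl
  have h5 := le_Gamma_add (n / p) (by positivity) l
  have h6 : (1 + p * l) / n = (1 / p + l) / (n / p) := by field_simp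
  rw [h6, div_pow, div_mul_div_comm]
  apply div_le_div₀
  · positivity
  · calc _ ≤ 1 / p * ((1 / p + l) ^ l * Real.Gamma (1 / p)) *
        (1 / p * Real.Gamma (1 / p)) ^ (n - 1) := by gcongr
      _ = _ := by ring
  · positivity
  · exact h5

/-- Radial projection onto `Delta`. -/
def TT (p : ℝ) (n : ℕ) (x : Fin n → ℝ) : Fin n → ℝ := (∑ i, x i ^ p) ^ (-(1 / p)) • x

lemma measurable_TT (p : ℝ) (n : ℕ) : Measurable (TT p n) := by
  unfold TT
  fun_prop

lemma N_nonneg (p : ℝ) (n : ℕ) (x : Fin n → ℝ) (hx : ∀ i, 0 ≤ x i) : 0 ≤ ∑ i, x i ^ p :=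
  Finset.sum_nonneg fun i _ => Real.rpow_nonneg (hx i) _

lemma eq_zero_of_N (p : ℝ) (hp : 0 < p) (n : ℕ) (x : Fin n → ℝ) (hx : ∀ i, 0 ≤ x i)
    (h : ∑ i, x i ^ p = 0) : x = 0 := by
  rw [Finset.sum_eq_zero_iff_of_nonneg fun i _ => Real.rpow_nonneg (hx i) _] at h
  ext i
  have := h i (Finset.mem_univ i)
  rwa [Real.rpow_eq_zero (hx i) hp.ne'] at this

lemma TT_mem (p : ℝ) (hp : 0 < p) (n : ℕ) (x : Fin n → ℝ) (hx : ∀ i, 0 ≤ x i)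
    (h : 0 < ∑ i, x i ^ p) : TT p n x ∈ Delta p n := by
  refine ⟨fun i => mul_nonneg (Real.rpow_nonneg h.le _) (hx i), ?_⟩
  unfold TT
  rw [N_smul p n _ (Real.rpow_nonneg h.le _) x hx, ← Real.rpow_mul h.le, neg_mul,
    one_div_mul_cancel hp.ne', Real.rpow_neg_one, inv_mul_cancel₀ h.ne']

lemma TT_smul (p : ℝ) (hp : 0 < p) (n : ℕ) (x : Fin n → ℝ) (hx : ∀ i, 0 ≤ x i)
    (r : ℝ) (hr : 0 < r) : TT p n (r • x) = TT p n x := by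
  unfold TT
  have h := N_nonneg p n x hx
  rw [N_smul p n r hr.le x hx, Real.mul_rpow (by positivity) h, ← Real.rpow_mul hr.le,
    mul_neg, mul_one_div_cancel hp.ne', Real.rpow_neg_one, smul_smul]
  congr 1
  field_simp

lemma TT_of_Delta (p : ℝ) (n : ℕ) (x : Fin n → ℝ) (hx : x ∈ Delta p n) : TT p n x = x := by
  unfold TT
  rw [hx.2, Real.one_rpow, one_smul]

lemma cone_sub (p : ℝ) (hp : 0 < p) (n : ℕ) (A : Set (Fin n → ℝ)) (hA : A ⊆ Delta p n) :
    cone A ⊆ {0} ∪ (TT p n ⁻¹' A ∩ DD p n 1) := by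
  rintro x ⟨t, ⟨ht0, ht1⟩, a, ha, rfl⟩
  rcases ht0.eq_or_lt with rfl | ht
  · left; simp
  · right
    have haD := hA ha
    refine ⟨?_, fun i => mul_nonneg ht0 (haD.1 i), ?_⟩
    · rw [mem_preimage, TT_smul p hp n a haD.1 t ht, TT_of_Delta p n a haD]
      exact ha
    · rw [N_smul p n t ht0 a haD.1, haD.2, mul_one]
      exact Real.rpow_le_one ht0 ht1 hp.le

lemma DD_sub (p : ℝ) (hp : 0 < p) (n : ℕ) : DD p n 1 ⊆ {0} ∪ cone (Delta p n) := by
  intro x hx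
  rcases (N_nonneg p n x hx.1).eq_or_lt with h | h
  · left; exact eq_zero_of_N p hp n x hx.1 h.symm
  · right
    refine ⟨(∑ i, x i ^ p) ^ (1 / p), ⟨Real.rpow_nonneg h.le _,
      Real.rpow_le_one h.le hx.2 (by positivity)⟩, TT p n x, TT_mem p hp n x hx.1 h, ?_⟩
    unfold TT
    rw [smul_smul, ← Real.rpow_add h, add_neg_cancel, Real.rpow_zero, one_smul]

lemma vol_zero (n : ℕ) (j : Fin n) : volume ({0} : Set (Fin n → ℝ)) = 0 := by
  have : Nonempty (Fin n) := ⟨j⟩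
  exact measure_singleton _

lemma vol_cone (p : ℝ) (hp : 0 < p) (n : ℕ) (j : Fin n) :
    volume (cone (Delta p n)) = volume (DD p n 1) := by
  apply le_antisymm
  · refine (measure_mono (cone_sub p hp n _ subset_rfl)).trans ((measure_union_le _ _).trans ?_)
    rw [vol_zero n j, zero_add]
    exact measure_mono inter_subset_right
  · refine (measure_mono (DD_sub p hp n)).trans ((measure_union_le _ _).trans ?_)
    rw [vol_zero n j, zero_add]

lemma mu_Delta (p : ℝ) (hp : 0 < p) (n : ℕ) (j : Fin n) (μ : Measure (Fin n → ℝ))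
    (hμ : IsConeMeasure p n μ) : ∀ᵐ x ∂μ, x ∈ Delta p n := by
  have := hμ.1
  have h := hμ.2 _ (measurableSet_Delta p n) subset_rfl
  rw [vol_cone p hp n j, ENNReal.div_self (vol_DD_pos p hp n j) (vol_DD_top p hp n j)] at h
  exact (mem_ae_iff_prob_eq_one (measurableSet_Delta p n)).2 h

lemma mu_le (p : ℝ) (hp : 0 < p) (n : ℕ) (j : Fin n) (μ : Measure (Fin n → ℝ))
    (hμ : IsConeMeasure p n μ) :
    μ ≤ (volume (DD p n 1))⁻¹ • (volume.restrict (DD p n 1)).map (TT p n) := by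
  refine Measure.le_iff.2 fun A hA => ?_
  have hd := mu_Delta p hp n j μ hμ
  have h1 : μ A ≤ μ (A ∩ Delta p n) := by
    exact measure_mono_ae (μ := μ) (hd.mono fun x hx hxA => ⟨hxA, hx⟩)
  refine h1.trans ?_
  rw [hμ.2 _ (hA.inter (measurableSet_Delta p n)) inter_subset_right, vol_cone p hp n j,
    Measure.smul_apply, smul_eq_mul, Measure.map_apply (measurable_TT p n) hA,
    Measure.restrict_apply (measurable_TT p n hA), ENNReal.div_eq_inv_mul]
  refine mul_le_mul_right ?_ _
  refine (measure_mono (μ := volume) (cone_sub p hp n _ inter_subset_right)).trans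
    ((measure_union_le _ _).trans ?_)
  rw [vol_zero n j, zero_add]
  exact measure_mono (inter_subset_inter_left _ (preimage_mono inter_subset_left))

lemma Delta_le_one (p : ℝ) (hp : 0 < p) (n : ℕ) (j : Fin n) (x : Fin n → ℝ)
    (hx : x ∈ Delta p n) : x j ≤ 1 := by
  have h : x j ^ p ≤ 1 := by
    rw [← hx.2]
    exact Finset.single_le_sum (f := fun i => x i ^ p)
      (fun i _ => Real.rpow_nonneg (hx.1 i) _) (Finset.mem_univ j)
  by_contra hc
  push Not at hc
  linarith [Real.one_lt_rpow hc hp]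

lemma H_le (p : ℝ) (hp : 0 < p) (n : ℕ) (j : Fin n) (l : ℕ) :
    ∫⁻ x in DD p n 1, ENNReal.ofReal (TT p n x j ^ (p * l))
      ≤ ENNReal.ofReal (2 * 2 ^ (p * l)) *
        ∫⁻ x in DD p n 1, ENNReal.ofReal (x j ^ (p * l)) := by
  set H := ∫⁻ x in DD p n 1, ENNReal.ofReal (TT p n x j ^ (p * l)) with hH
  set J := ∫⁻ x in DD p n 1, ENNReal.ofReal (x j ^ (p * l)) with hJ
  have hmT : Measurable fun x : Fin n → ℝ => ENNReal.ofReal (TT p n x j ^ (p * l)) := by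
    have := (measurable_pi_apply j).comp (measurable_TT p n)
    exact (this.pow_const _).ennreal_ofReal
  have hmJ : Measurable fun x : Fin n → ℝ => ENNReal.ofReal (x j ^ (p * l)) := by fun_prop
  have hfin : H ≠ ⊤ := by
    have : H ≤ ∫⁻ x in DD p n 1, 1 := by
      refine setLIntegral_mono measurable_const fun x hx => ?_
      rw [← ENNReal.ofReal_one]
      apply ENNReal.ofReal_le_ofReal
      rcases (N_nonneg p n x hx.1).eq_or_lt with h | h
      · have := eq_zero_of_N p hp n x hx.1 h.symm
        subst this
        simp only [TT, smul_zero, Pi.zero_apply]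
        exact Real.rpow_le_one le_rfl zero_le_one (by positivity)
      · have hm := TT_mem p hp n x hx.1 h
        exact Real.rpow_le_one (hm.1 j) (Delta_le_one p hp n j _ hm) (by positivity)
    refine ne_top_of_le_ne_top ?_ this
    simpa using vol_DD_top p hp n j
  set r : ℝ := 1 / 2 with hr
  have hr0 : 0 < r := by norm_num [hr]
  have h1 : ∫⁻ x in DD p n (r ^ p), ENNReal.ofReal (TT p n x j ^ (p * l)) ≤ H / 2 := by
    rw [setLIntegral_DD_scale p n r hr0 _ hmT]
    have : ∫⁻ x in DD p n 1, ENNReal.ofReal (TT p n (r • x) j ^ (p * l)) = H := by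
      refine setLIntegral_congr_fun (measurableSet_DD p n 1) fun x hx => ?_
      rw [TT_smul p hp n x hx.1 r hr0]
    rw [this, ENNReal.div_eq_inv_mul]
    gcongr
    have h2 : (2 : ℝ≥0∞)⁻¹ = ENNReal.ofReal r := by
      rw [hr, one_div, ENNReal.ofReal_inv_of_pos two_pos]; simp
    rw [h2]
    apply ENNReal.ofReal_le_ofReal
    exact pow_le_of_le_one hr0.le (by norm_num [hr]) j.pos.ne'
  have h2 : ∫⁻ x in DD p n 1 \ DD p n (r ^ p), ENNReal.ofReal (TT p n x j ^ (p * l))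
      ≤ ENNReal.ofReal (2 ^ (p * l)) * J := by
    calc _ ≤ ∫⁻ x in DD p n 1 \ DD p n (r ^ p),
          ENNReal.ofReal (2 ^ (p * l)) * ENNReal.ofReal (x j ^ (p * l)) := by
          refine setLIntegral_mono (hmJ.const_mul _) fun x hx => ?_
          have hN : r ^ p < ∑ i, x i ^ p := by
            by_contra hc
            exact hx.2 ⟨hx.1.1, not_lt.1 hc⟩
          have hrp : 0 < r ^ p := Real.rpow_pos_of_pos hr0 _
          have h3 : (∑ i, x i ^ p) ^ (-(1 / p)) ≤ 2 := by
            calc _ ≤ (r ^ p) ^ (-(1 / p)) :=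
                  Real.rpow_le_rpow_of_nonpos hrp hN.le (by
                    have : 0 < 1 / p := by positivity
                    linarith)
              _ = 2 := by
                rw [← Real.rpow_mul hr0.le, mul_neg, mul_one_div_cancel hp.ne',
                  Real.rpow_neg_one, hr]
                norm_num
          have hxj := hx.1.1 j
          have hN0 := hrp.trans hN
          rw [← ENNReal.ofReal_mul (by positivity), ← Real.mul_rpow two_pos.le hxj]
          apply ENNReal.ofReal_le_ofReal
          refine Real.rpow_le_rpow ?_ ?_ (by positivity)
          · exact mul_nonneg (Real.rpow_nonneg hN0.le _) hxj
          · exact mul_le_mul_of_nonneg_right h3 hxj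
      _ = ENNReal.ofReal (2 ^ (p * l)) * ∫⁻ x in DD p n 1 \ DD p n (r ^ p),
          ENNReal.ofReal (x j ^ (p * l)) := lintegral_const_mul _ hmJ
      _ ≤ _ := by
        gcongr
        exact lintegral_mono_set sdiff_subset
  have h3 : H ≤ H / 2 + ENNReal.ofReal (2 ^ (p * l)) * J := by
    calc H ≤ ∫⁻ x in DD p n (r ^ p) ∪ (DD p n 1 \ DD p n (r ^ p)),
            ENNReal.ofReal (TT p n x j ^ (p * l)) := by
          apply lintegral_mono_set
          intro x hx
          by_cases h : x ∈ DD p n (r ^ p)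
          · exact Or.inl h
          · exact Or.inr ⟨hx, h⟩
      _ ≤ _ := lintegral_union_le _ _ _
      _ ≤ _ := add_le_add h1 h2
  have h4 : H / 2 ≤ ENNReal.ofReal (2 ^ (p * l)) * J := by
    nth_rewrite 1 [← ENNReal.add_halves H] at h3
    exact (ENNReal.add_le_add_iff_left (ENNReal.div_ne_top hfin (by simp))).1 h3
  rw [ENNReal.ofReal_mul two_pos.le, mul_assoc]
  calc H = 2 * (H / 2) := (ENNReal.mul_div_cancel (by simp) (by simp)).symm
    _ ≤ _ := by
      gcongr
      simp

lemma moment_le (p : ℝ) (hp : 0 < p) (n : ℕ) (j : Fin n) (l : ℕ) (μ : Measure (Fin n → ℝ))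
    (hμ : IsConeMeasure p n μ) :
    ∫⁻ x, ENNReal.ofReal (x j ^ (p * l)) ∂μ
      ≤ ENNReal.ofReal (2 * 2 ^ (p * l) * ((1 + p * l) / n) ^ l) := by
  have hmJ : Measurable fun x : Fin n → ℝ => ENNReal.ofReal (x j ^ (p * l)) := by fun_prop
  have hV := vol_DD_pos p hp n j
  have hV' := vol_DD_top p hp n j
  calc _ ≤ ∫⁻ x, ENNReal.ofReal (x j ^ (p * l))
        ∂((volume (DD p n 1))⁻¹ • (volume.restrict (DD p n 1)).map (TT p n)) :=
        lintegral_mono' (mu_le p hp n j μ hμ) le_rfl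
    _ = (volume (DD p n 1))⁻¹ *
        ∫⁻ x in DD p n 1, ENNReal.ofReal (TT p n x j ^ (p * l)) := by
        rw [lintegral_smul_measure, lintegral_map hmJ (measurable_TT p n), smul_eq_mul]
    _ ≤ (volume (DD p n 1))⁻¹ * (ENNReal.ofReal (2 * 2 ^ (p * l)) *
        (ENNReal.ofReal (((1 + p * l) / n) ^ l) * volume (DD p n 1))) := by
        gcongr
        exact (H_le p hp n j l).trans (by gcongr; exact J_le p hp n j l)
    _ = _ := by
        rw [ENNReal.ofReal_mul (p := 2 * 2 ^ (p * l)) (by positivity), ← mul_assoc (ENNReal.ofReal _), mul_comm,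
          mul_assoc, ENNReal.mul_inv_cancel hV hV', mul_one]

lemma kthMax_nonneg (n k : ℕ) (hk : k ≤ n) (x : Fin n → ℝ) : 0 ≤ kthMax x k := by
  apply Real.sSup_nonneg'
  exact ⟨0, ⟨Finset.univ, by simpa using hk, fun j _ => abs_nonneg _⟩, le_rfl⟩

lemma kthMax_le (n k : ℕ) (hk0 : 0 < k) (hk : k ≤ n) (x : Fin n → ℝ) (hx : ∀ i, 0 ≤ x i)
    (a q : ℝ) (ha : 0 < a) (hq : 1 ≤ q) :
    kthMax x k ≤ a + a / (a ^ q * k) * ∑ i, x i ^ q := by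
  have hs : 0 ≤ ∑ i, x i ^ q := Finset.sum_nonneg fun i _ => Real.rpow_nonneg (hx i) _
  have hk' : (0 : ℝ) < k := by exact_mod_cast hk0
  apply csSup_le
  · exact ⟨0, Finset.univ, by simpa using hk, fun j _ => abs_nonneg _⟩
  · rintro t ⟨S, hS, ht⟩
    rcases le_or_gt t a with h | h
    · have : 0 ≤ a / (a ^ q * k) * ∑ i, x i ^ q := by positivity
      linarith
    · have ht0 : 0 < t := ha.trans h
      have h1 : k * t ^ q ≤ ∑ i, x i ^ q := by
        calc (k : ℝ) * t ^ q ≤ S.card * t ^ q := by gcongr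
          _ = ∑ i ∈ S, t ^ q := by simp
          _ ≤ ∑ i ∈ S, x i ^ q := by
            refine Finset.sum_le_sum fun i hi => ?_
            have := ht i hi
            rw [abs_of_nonneg (hx i)] at this
            exact Real.rpow_le_rpow ht0.le this (by linarith)
          _ ≤ _ := Finset.sum_le_sum_of_subset_of_nonneg (Finset.subset_univ _)
            fun i _ _ => Real.rpow_nonneg (hx i) _
      have h2 : t / a ≤ (t / a) ^ q := by
        have : 1 ≤ t / a := (one_le_div ha).2 h.le
        simpa using Real.rpow_le_rpow_of_exponent_le this hq
      rw [Real.div_rpow ht0.le ha.le] at h2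
      have h3 : t ≤ a * (t ^ q / a ^ q) := by
        rwa [div_le_iff₀' ha] at h2
      have h4 : a * (t ^ q / a ^ q) = a / (a ^ q * k) * (k * t ^ q) := by
        have : 0 < a ^ q := by positivity
        field_simp
      have h5 : a / (a ^ q * k) * (k * t ^ q) ≤ a / (a ^ q * k) * ∑ i, x i ^ q := by gcongr
      linarith

lemma integral_kthMax_le (p : ℝ) (hp : 0 < p) (n k : ℕ) (hk0 : 0 < k) (hk : k ≤ n)
    (μ : Measure (Fin n → ℝ)) (hμ : IsConeMeasure p n μ) (l : ℕ) (hl : 1 ≤ p * l)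
    (a : ℝ) (ha : 0 < a)
    (hM : n / k * (2 * 2 ^ (p * l) * ((1 + p * l) / n) ^ l) ≤ a ^ (p * l)) :
    ∫ x, kthMax x k ∂μ ≤ 2 * a := by
  have := hμ.1
  have hk' : (0 : ℝ) < k := by exact_mod_cast hk0
  set M := 2 * 2 ^ (p * l) * ((1 + p * l) / n) ^ l with hMdef
  have hM0 : 0 ≤ M := by positivity
  have j0 : Fin n := ⟨0, by omega⟩
  have hD := mu_Delta p hp n j0 μ hμ
  have hnn : ∀ j : Fin n, 0 ≤ᵐ[μ] fun x => x j ^ (p * l) := by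
    intro j
    filter_upwards [hD] with x hx using Real.rpow_nonneg (hx.1 j) _
  have hms : ∀ j : Fin n, AEStronglyMeasurable (fun x : Fin n → ℝ => x j ^ (p * l)) μ :=
    fun j => Measurable.aestronglyMeasurable (by fun_prop)
  have hint : ∀ j : Fin n, Integrable (fun x : Fin n → ℝ => x j ^ (p * l)) μ := by
    intro j
    refine ⟨hms j, ?_⟩
    rw [hasFiniteIntegral_iff_ofReal (hnn j)]
    exact (moment_le p hp n j l μ hμ).trans_lt ENNReal.ofReal_lt_top
  have hval : ∀ j : Fin n, ∫ x, x j ^ (p * l) ∂μ ≤ M := by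
    intro j
    rw [integral_eq_lintegral_of_nonneg_ae (hnn j) (hms j)]
    exact ENNReal.toReal_le_of_le_ofReal hM0 (moment_le p hp n j l μ hμ)
  have hsum : Integrable (fun x : Fin n → ℝ => ∑ i, x i ^ (p * l)) μ :=
    integrable_finsetSum _ fun i _ => hint i
  have hapos : 0 < a ^ (p * l) := by positivity
  calc ∫ x, kthMax x k ∂μ
      ≤ ∫ x, (a + a / (a ^ (p * l) * k) * ∑ i, x i ^ (p * l)) ∂μ := by
        refine integral_mono_of_nonneg ?_ ?_ ?_
        · exact Filter.Eventually.of_forall fun x => kthMax_nonneg n k hk x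
        · exact (integrable_const _).add (hsum.const_mul _)
        · filter_upwards [hD] with x hx using kthMax_le n k hk0 hk x hx.1 a _ ha hl
    _ = a + a / (a ^ (p * l) * k) * ∑ i, ∫ x, x i ^ (p * l) ∂μ := by
        rw [integral_add (integrable_const _) (hsum.const_mul _), integral_const_mul,
          integral_finsetSum _ fun i _ => hint i]
        simp
    _ ≤ a + a / (a ^ (p * l) * k) * ∑ i : Fin n, M := by
        gcongr with i
        exact hval i
    _ = a + a / a ^ (p * l) * (n / k * M) := by
        simp only [Finset.sum_const, Finset.card_univ, Fintype.card_fin, nsmul_eq_mul]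
        field_simp
    _ ≤ a + a / a ^ (p * l) * a ^ (p * l) := by gcongr
    _ = 2 * a := by
        rw [div_mul_cancel₀ _ hapos.ne']; ring

/-- For `0 < p < ∞` there is `C_p > 0` (depending only on `p`) such that for all `n ≥ 2` and
`0 ≤ m ≤ n-1`, `σ_m^{p,∞}(μ_p) = ∫_{Δ_p^n} x_{m+1}^* dμ_p(x) ≤ C_p (log(en/(m+1))/n)^{1/p}`. -/
theorem average_best_m_term_width_cone_upper (p : ℝ) (hp : 0 < p) :
    ∃ C : ℝ, 0 < C ∧ ∀ n : ℕ, 2 ≤ n → ∀ m : ℕ, m ≤ n - 1 →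
      ∀ μ : Measure (Fin n → ℝ), IsConeMeasure p n μ →
        ∫ x, kthMax x (m + 1) ∂μ
          ≤ C * (Real.log (Real.exp 1 * n / ((m : ℝ) + 1)) / n) ^ (1 / p) := by
  refine ⟨2 * (4 * Real.exp 1 * 2 ^ p * (2 + 2 * p)) ^ (1 / p), by positivity, ?_⟩
  intro n hn m hm μ hμ
  have hkn : m + 1 ≤ n := by omega
  have hn0 : (0 : ℝ) < n := by exact_mod_cast (by omega : 0 < n)
  have hk0 : (0 : ℝ) < (m : ℝ) + 1 := by positivity
  have hkn' : (m : ℝ) + 1 ≤ n := by exact_mod_cast hkn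
  set L := Real.log (Real.exp 1 * n / ((m : ℝ) + 1)) with hL
  have hexpL : Real.exp L = Real.exp 1 * n / ((m : ℝ) + 1) := Real.exp_log (by positivity)
  have hL1 : 1 ≤ L := by
    rw [hL, Real.le_log_iff_exp_le (by positivity), le_div_iff₀ hk0]
    gcongr
  obtain ⟨l, hl1, hl2⟩ : ∃ l : ℕ, L + 1 / p ≤ l ∧ (l : ℝ) < L + 1 / p + 1 :=
    ⟨⌈L + 1 / p⌉₊, Nat.le_ceil _, Nat.ceil_lt_add_one (by positivity)⟩
  have hp1 : 0 < 1 / p := by positivity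
  have hpp : p * (1 / p) = 1 := mul_one_div_cancel hp.ne'
  have hLl : L ≤ l := by linarith
  have hpl : 1 ≤ p * l := by nlinarith
  have hlpos : 1 ≤ l := by
    have : (1 : ℝ) ≤ l := by linarith
    exact_mod_cast this
  set b := 4 * Real.exp 1 * 2 ^ p * (1 + p * l) / n with hb
  have hb0 : 0 < b := by positivity
  have ha0 : 0 < b ^ (1 / p) := by positivity
  have key := integral_kthMax_le p hp n (m + 1) (by omega) hkn μ hμ l hpl (b ^ (1 / p)) ha0 ?_
  · refine key.trans ?_
    rw [mul_assoc, ← Real.mul_rpow (by positivity) (by positivity)]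
    gcongr
    rw [hb, ← mul_div_assoc]
    gcongr ?_ / _
    rw [mul_assoc _ (2 + 2 * p)]
    gcongr
    nlinarith
  · rw [← Real.rpow_mul hb0.le, ← mul_assoc (1 / p), one_div_mul_cancel hp.ne', one_mul, Real.rpow_natCast,
      Real.rpow_mul two_pos.le, Real.rpow_natCast]
    push_cast
    have h1 : (n : ℝ) / (m + 1) ≤ Real.exp 1 ^ l := by
      calc (n : ℝ) / (m + 1) ≤ Real.exp 1 * n / ((m : ℝ) + 1) := by
            gcongr
            have := Real.one_le_exp zero_le_one
            nlinarith
        _ = Real.exp L := hexpL.symm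
        _ ≤ Real.exp l := Real.exp_le_exp.2 hLl
        _ = _ := by rw [← Real.exp_nat_mul, mul_one]
    have h2 : (2 : ℝ) ≤ 4 ^ l := by
      calc (2 : ℝ) ≤ 4 ^ 1 := by norm_num
        _ ≤ 4 ^ l := pow_le_pow_right₀ (by norm_num) hlpos
    calc (n : ℝ) / (m + 1) * (2 * (2 ^ p) ^ l * ((1 + p * l) / n) ^ l)
        ≤ Real.exp 1 ^ l * (4 ^ l * (2 ^ p) ^ l * ((1 + p * l) / n) ^ l) := by gcongr
      _ = b ^ l := by
        rw [hb, ← mul_pow, ← mul_pow, ← mul_pow]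
        congr 1; ring

end
end

section
/- Let 0<p<∞. There is a constant C_p depending only on p such that (1/m) Σ_{j=1}^m (log(en/j))^{1/p} ≤ C_p · (log(en/m))^{1/p} for all natural numbers 1 ≤ m ≤ n. -/
open Real

noncomputable section

lemma sum_inv_sqrt_le (m : ℕ) :
    ∑ j ∈ Finset.Icc 1 m, 1 / √(j : ℝ) ≤ 2 * √(m : ℝ) := by
  induction m with
  | zero => simp
  | succ k ih =>
    rw [Finset.sum_Icc_succ_top (by omega)]
    have hb : 0 < √((k + 1 : ℕ) : ℝ) := Real.sqrt_pos.2 (by positivity)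
    have ha : 0 ≤ √(k : ℝ) := Real.sqrt_nonneg _
    have hb2 : √((k + 1 : ℕ) : ℝ) ^ 2 = k + 1 := by
      rw [Real.sq_sqrt (by positivity)]; push_cast; ring
    have ha2 : √(k : ℝ) ^ 2 = k := Real.sq_sqrt (by positivity)
    have : 1 / √((k + 1 : ℕ) : ℝ) ≤ 2 * √((k + 1 : ℕ) : ℝ) - 2 * √(k : ℝ) := by
      rw [div_le_iff₀ hb]
      nlinarith [sq_nonneg (√((k + 1 : ℕ) : ℝ) - √(k : ℝ))]
    linarith

/-- For `0 < p < ∞` there is `C_p > 0` (depending only on `p`) such that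
`(1/m) ∑_{j=1}^m (log(en/j))^{1/p} ≤ C_p (log(en/m))^{1/p}` for all `1 ≤ m ≤ n`. -/
theorem log_sum_average_bound (p : ℝ) (hp : 0 < p) :
    ∃ C : ℝ, 0 < C ∧ ∀ n m : ℕ, 1 ≤ m → m ≤ n →
      (1 / (m : ℝ)) * ∑ j ∈ Finset.Icc 1 m, (Real.log (Real.exp 1 * n / j)) ^ (1 / p)
        ≤ C * (Real.log (Real.exp 1 * n / m)) ^ (1 / p) := by
  have hε : 0 < p / 2 := by positivity
  set K : ℝ := 1 + 1 / (p / 2) with hK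
  have hK0 : 0 < K := by positivity
  refine ⟨2 * K ^ (1 / p), by positivity, ?_⟩
  intro n m hm hmn
  have hm0 : (0 : ℝ) < m := by exact_mod_cast hm
  have hmn' : (m : ℝ) ≤ n := by exact_mod_cast hmn
  have hn0 : (0 : ℝ) < n := by linarith
  set L := Real.log (Real.exp 1 * n / m) with hL
  have hL1 : 1 ≤ L := by
    rw [hL, Real.le_log_iff_exp_le (by positivity), le_div_iff₀ hm0]
    gcongr
  have key : ∀ j ∈ Finset.Icc 1 m, (Real.log (Real.exp 1 * n / j)) ^ (1 / p)
      ≤ (L ^ (1 / p) * K ^ (1 / p) * √(m : ℝ)) * (1 / √(j : ℝ)) := by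
    intro j hj
    rw [Finset.mem_Icc] at hj
    have hj0 : (0 : ℝ) < j := by exact_mod_cast hj.1
    have hjm : (j : ℝ) ≤ m := by exact_mod_cast hj.2
    have hx : 1 ≤ (m : ℝ) / j := by rwa [le_div_iff₀ hj0, one_mul]
    have hx0 : 0 < (m : ℝ) / j := by positivity
    have e1 : Real.log (Real.exp 1 * n / j) = L + Real.log (m / j) := by
      rw [hL, ← Real.log_mul (by positivity) (by positivity)]
      congr 1
      field_simp
    have hlog0 : 0 ≤ Real.log ((m : ℝ) / j) := Real.log_nonneg hx
    have h1 : Real.log ((m : ℝ) / j) ≤ ((m : ℝ) / j) ^ (p / 2) / (p / 2) :=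
      Real.log_le_rpow_div hx0.le hε
    have h2 : 1 ≤ ((m : ℝ) / j) ^ (p / 2) := Real.one_le_rpow hx hε.le
    have h3 : 1 + Real.log ((m : ℝ) / j) ≤ K * ((m : ℝ) / j) ^ (p / 2) := by
      have : K * ((m : ℝ) / j) ^ (p / 2)
          = ((m : ℝ) / j) ^ (p / 2) + ((m : ℝ) / j) ^ (p / 2) / (p / 2) := by
        rw [hK]; ring
      linarith
    have h4 : L + Real.log ((m : ℝ) / j) ≤ L * (K * ((m : ℝ) / j) ^ (p / 2)) := by
      nlinarith
    have e2 : (((m : ℝ) / j) ^ (p / 2)) ^ (1 / p) = √(m : ℝ) * (1 / √(j : ℝ)) := by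
      rw [← Real.rpow_mul hx0.le, show p / 2 * (1 / p) = 1 / 2 by field_simp,
        ← Real.sqrt_eq_rpow, Real.sqrt_div hm0.le]
      ring
    rw [e1]
    calc (L + Real.log ((m : ℝ) / j)) ^ (1 / p)
        ≤ (L * (K * ((m : ℝ) / j) ^ (p / 2))) ^ (1 / p) :=
          Real.rpow_le_rpow (by linarith) h4 (by positivity)
      _ = _ := by
          rw [Real.mul_rpow (by linarith) (by positivity),
            Real.mul_rpow hK0.le (by positivity), e2]
          ring
  have hLp : 0 ≤ L ^ (1 / p) := Real.rpow_nonneg (by linarith) _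
  have hKp : 0 ≤ K ^ (1 / p) := by positivity
  have hsum := Finset.sum_le_sum key
  rw [← Finset.mul_sum] at hsum
  have h5 := hsum.trans (mul_le_mul_of_nonneg_left (sum_inv_sqrt_le m)
    (by positivity : 0 ≤ L ^ (1 / p) * K ^ (1 / p) * √(m : ℝ)))
  have hs : √(m : ℝ) * √(m : ℝ) = m := Real.mul_self_sqrt hm0.le
  rw [one_div_mul_eq_div, div_le_iff₀ hm0]
  refine h5.trans (le_of_eq ?_)
  linear_combination (2 * L ^ (1 / p) * K ^ (1 / p)) * hs

end
end
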